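/- Let h₁(x) = 217019x² + 87907368140554183100162x + 4508281300847688731169319769769841835444, h₂(x) = 37258218541488534910719399x² + 246529569778532375140876985021306849541294312x + 14635567009082568185596461891292367332677180975427256879233264, h₃(x) = 2223585235421468919x² + 274156098050901691661379937349434622x + 8443409213944751989643951279235627283533452107433272, h₄(x) = 13385859493702x³ + 225702085730490664288660568855789598873301353168x + 16436156522418265669179020769359057896808189915554213257292620245, and let h(x) = h₁(x)⁵·h₂(x) − t·h₃(x)³·h₄(x), a polynomial of degree 12 in x with coefficients in ℚ(t). Then the Galois group of (the splitting field of) h over ℚ(t) is a simple group of cardinality 7920 (i.e., it is isomorphic to the Mathieu group M₁₁). -/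

import Mathlib

open Polynomial

/-- The generator `t` of the rational function field `ℚ(t)`. -/
noncomputable def t : RatFunc ℚ := RatFunc.X

noncomputable def h1 : Polynomial (RatFunc ℚ) :=
  C 217019 * X ^ 2 + C 87907368140554183100162 * X +
    C 4508281300847688731169319769769841835444

noncomputable def h2 : Polynomial (RatFunc ℚ) :=
  C 37258218541488534910719399 * X ^ 2 +
    C 246529569778532375140876985021306849541294312 * X +
    C 14635567009082568185596461891292367332677180975427256879233264

noncomputable def h3 : Polynomial (RatFunc ℚ) :=
  C 2223585235421468919 * X ^ 2 +
    C 274156098050901691661379937349434622 * X +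
    C 8443409213944751989643951279235627283533452107433272

noncomputable def h4 : Polynomial (RatFunc ℚ) :=
  C 13385859493702 * X ^ 3 +
    C 225702085730490664288660568855789598873301353168 * X +
    C 16436156522418265669179020769359057896808189915554213257292620245

/-- `h(x) = h₁(x)⁵ h₂(x) − t · h₃(x)³ h₄(x)` over `ℚ(t)`. -/
noncomputable def h : Polynomial (RatFunc ℚ) := h1 ^ 5 * h2 - C t * (h3 ^ 3 * h4)


section
set_option autoImplicit false
open Equiv
namespace M11G
def DD : List ℕ := [2954,1814,3628,3162,2230,366,732,1464,2928,1762,3524,1141,2281,467,933,1865,3729,3363,2631,1167,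
  2333,571]

def tau0 : List ℕ := [1,0,3,9,11,6,10,5,8,2,4,7]

def TL : List (List ℕ × List ℕ × List ℕ) := 
  [([1,0,2,3,5,4,11,10,8,9,7,6],[6,2,7,1,3],[7,6,4]),([1,0,2,6,8,4,10,11,5,7,9,3],[10,7,2,2],[2,1,5,
  8,2]),([1,0,2,7,4,8,9,3,5,6,10,11],[2,1,7,9,8],[1,0,9,0]),([1,0,2,9,4,5,7,6,8,3,11,10],[1,1,3,9,
  7],[5,4,10,2]),([1,0,2,10,8,5,6,7,4,11,3,9],[6,1,4,4],[8,9,1]),([1,0,2,11,5,8,3,9,4,10,6,7],[5,2,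
  6,5],[7,1,4,3]),([1,0,3,2,6,11,4,7,8,9,10,5],[3,2,6,5],[9,0,8,0]),([1,0,3,4,6,8,2,9,11,7,5,10],[7,
  2,4,8],[5,10,8]),([1,0,3,5,8,11,7,4,6,10,9,2],[1,0,2,0],[9,1,3]),([1,0,3,7,8,6,5,10,11,4,2,9],[3,
  7,8,10],[5,0,2,8,9]),([1,0,3,9,11,6,10,5,8,2,4,7],[0,0],[0,0]),([1,0,3,10,11,8,9,2,6,5,7,4],[2,5,
  5,8],[2,5,10]),([1,0,4,3,10,2,8,5,11,7,9,6],[3,9,2],[4,0,7,0]),([1,0,4,5,11,10,6,9,2,8,3,7],[5,10,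
  7],[4,0,5,1,3]),([1,0,4,6,11,2,5,8,10,9,7,3],[0,3,0,8],[4,7,6]),([1,0,4,7,2,10,9,6,11,3,8,5],[1,
  0,9,0],[8,0,4,8,9]),([1,0,4,8,10,11,3,7,2,5,6,9],[2,3,10],[2,2,9,7]),([1,0,4,9,2,11,7,3,10,6,5,8],
  [0,9,0,5],[2,3,1,8]),([1,0,5,3,2,7,11,9,6,10,4,8],[5,2,2,4],[6,4,7]),([1,0,5,4,7,6,10,3,2,8,9,11],
  [1,6,1,2],[7,0,10,0]),([1,0,5,8,6,7,9,11,2,4,10,3],[7,7,3,9],[1,2,8,2]),([1,0,5,9,6,2,8,4,7,11,3,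
  10],[3,0,9,0],[6,9,10,1]),([1,0,5,10,7,2,4,8,6,3,11,9],[5,2,4,2],[8,0,5,0]),([1,0,5,11,2,6,3,10,
  7,9,8,4],[10,3,8],[10,3,4,5]),([1,0,6,2,3,10,4,9,5,7,11,8],[9,3,6],[6,2,1,6]),([1,0,6,4,3,5,2,7,
  10,9,8,11],[3,8,2],[0,3,0,1]),([1,0,6,7,10,3,11,8,5,2,4,9],[6,2,5,3],[3,4,5,1]),([1,0,6,8,5,10,9,
  4,3,11,7,2],[1,4,3,8],[9,6,10,4]),([1,0,6,9,5,3,8,11,10,4,2,7],[10,4,1,3],[4,8,3,10]),([1,0,6,11,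
  10,5,7,2,3,8,9,4],[1,2,3],[3,1,8,10]),([1,0,7,2,11,9,8,10,5,6,3,4],[0,7,0,5],[1,1,1,1]),([1,0,7,
  3,9,5,6,2,11,4,10,8],[3,9,5,3],[1,5,5,4]),([1,0,7,4,5,9,10,8,11,3,6,2],[7,3,4],[10,4,6,8]),([1,0,
  7,6,9,11,3,4,5,2,8,10],[4,1,3,8],[10,5,9,8]),([1,0,7,8,11,5,2,6,9,10,4,3],[8,1,7,2],[9,5,7,9]),([1,
  0,7,10,5,11,4,3,9,8,2,6],[8,4,9,4],[7,5,8,1]),([1,0,8,4,9,3,11,6,2,5,7,10],[10,6,7,5],[7,2,6,3]),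
  ([1,0,8,5,3,9,7,10,2,4,11,6],[10,3,2,3],[10,2,10,10]),([1,0,8,6,2,9,10,7,3,11,4,5],[6,0,7,0],[4,
  2,4,8]),([1,0,8,7,3,2,5,4,9,10,6,11],[1,6,5,5],[3,2,5]),([1,0,8,10,2,3,6,11,9,7,5,4],[0,5,0,7],[6,
  1,9,4]),([1,0,8,11,9,2,4,5,3,6,10,7],[4,6,10,9],[2,0,4,0]),([1,0,9,2,10,7,5,11,8,3,6,4],[5,0,5,0],
  [6,0,6,0]),([1,0,9,3,7,10,6,4,8,2,5,11],[10,1,2,5,7],[2,1,6,2]),([1,0,9,4,8,7,11,5,10,6,3,2],[2,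
  0,3,0],[10,0,2,0]),([1,0,9,5,10,8,2,3,7,11,4,6],[3,3,3,3],[6,6,5,3]),([1,0,9,6,7,8,3,2,10,4,11,5],
  [10,1,2,4],[5,0,3,0]),([1,0,9,11,8,10,4,6,7,5,2,3],[0,2,0,8],[8,2,7,5]),([1,0,10,2,9,6,5,3,4,11,
  7,8],[10,1,2,9],[0,10,0,2]),([1,0,10,3,4,9,8,7,6,5,2,11],[9,7,6,2],[1,3,2]),([1,0,10,5,9,4,2,11,
  6,3,8,7],[0,2,0,5],[9,2,3,1]),([1,0,10,7,6,4,11,2,9,8,3,5],[1,3,9,1],[2,8,2,7]),([1,0,10,8,4,6,3,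
  5,9,7,11,2],[7,6,4],[0,2,0,4]),([1,0,10,11,6,9,7,8,4,2,5,3],[3,2,10,10],[10,8,9]),([1,0,11,2,7,3,
  8,6,4,10,9,5],[8,4,7,8],[9,3,5,2]),([1,0,11,5,4,3,6,8,7,9,10,2],[3,2,7,4],[5,1,5,5]),([1,0,11,6,
  4,7,5,9,3,8,2,10],[7,0,1,9,7],[3,5,2,2]),([1,0,11,8,7,4,2,10,3,6,5,9],[3,4,3,1],[8,3,10,9]),([1,
  0,11,9,3,4,10,2,7,5,6,8],[6,0,3,3,2],[4,3,6,7]),([1,0,11,10,3,7,9,5,4,2,8,6],[6,2,5,5],[4,10,2,10])]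

def chk (S S' : ℕ) : ℕ → List ℕ → Bool
  | _, [] => true
  | i, c :: l => (S.testBit i == S'.testBit c) && chk S S' (i+1) l

def consB (l : List ℕ) : Bool := DD.all fun S => DD.any fun S' => chk S S' 0 l

def stepB (L : List (List ℕ)) : List (List ℕ) :=
  L.flatMap fun l => ((List.range 12).filter
    (fun c => !l.contains c && consB (l ++ [c]))).map (fun c => l ++ [c])

def lev : ℕ → List (List ℕ) → List (List ℕ)
  | 0, L => L
  | n+1, L => lev n (stepB L)

def gv (g : Perm (Fin 12)) (i : ℕ) : ℕ := if h : i < 12 then (g ⟨i, h⟩).val else 0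

def vals (g : Perm (Fin 12)) (k : ℕ) : List ℕ := (List.range k).map (gv g)

def pres (g : Perm (Fin 12)) : Prop :=
  ∀ S ∈ DD, ∃ S' ∈ DD, ∀ i : Fin 12, S.testBit i = S'.testBit (g i)

lemma chk_of (g : Perm (Fin 12)) (S S' : ℕ) (hS : ∀ i : Fin 12, S.testBit i = S'.testBit (g i)) :
    ∀ (n i : ℕ), i + n ≤ 12 → chk S S' i ((List.range' i n).map (gv g)) = true := by
  intro n
  induction n with
  | zero => intro i _; rfl
  | succ n ih =>
    intro i hi
    have h1 : i < 12 := by omega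
    simp only [List.range'_succ, List.map_cons, chk, Bool.and_eq_true, beq_iff_eq]
    refine ⟨?_, ih (i+1) (by omega)⟩
    have := hS ⟨i, h1⟩
    simpa [gv, h1] using this

lemma cons_vals (g : Perm (Fin 12)) (hg : pres g) (k : ℕ) (hk : k ≤ 12) :
    consB (vals g k) = true := by
  unfold consB
  rw [List.all_eq_true]
  intro S hS
  obtain ⟨S', hS', h⟩ := hg S hS
  rw [List.any_eq_true]
  refine ⟨S', hS', ?_⟩
  have := chk_of g S S' h k 0 (by omega)
  rwa [← List.range_eq_range'] at this

lemma vals_succ (g : Perm (Fin 12)) (k : ℕ) : vals g (k+1) = vals g k ++ [gv g k] := by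
  simp [vals, List.range_succ]

lemma gv_lt (g : Perm (Fin 12)) (i : ℕ) : gv g i < 12 := by
  unfold gv; split <;> omega

lemma lev_mem (g : Perm (Fin 12)) (hg : pres g) :
    ∀ (n k : ℕ) (L : List (List ℕ)), k + n ≤ 12 → vals g k ∈ L → vals g (k+n) ∈ lev n L := by
  intro n
  induction n with
  | zero => intro k L _ h; exact h
  | succ n ih =>
    intro k L hk h
    have : vals g (k+1) ∈ stepB L := by
      unfold stepB
      rw [List.mem_flatMap]
      refine ⟨vals g k, h, ?_⟩
      rw [List.mem_map]
      refine ⟨gv g k, ?_, (vals_succ g k).symm⟩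
      rw [List.mem_filter, Bool.and_eq_true]
      refine ⟨List.mem_range.2 (gv_lt g k), ?_, ?_⟩
      · rw [Bool.not_eq_true', List.contains_eq_mem, decide_eq_false_iff_not]
        intro hm
        simp only [vals, List.mem_map, List.mem_range] at hm
        obtain ⟨j, hj, hjk⟩ := hm
        have hj2 : j < 12 := by omega
        have hk2 : k < 12 := by omega
        simp only [gv, hj2, hk2, dif_pos] at hjk
        have := g.injective (Fin.ext hjk)
        simp at this
        omega
      · rw [← vals_succ]; exact cons_vals g hg _ (by omega)
    have := ih (k+1) (stepB L) (by omega) this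
    rw [show k + (n+1) = k + 1 + n by ring]
    exact this

set_option maxRecDepth 100000 in
lemma dfs1 : lev 2 [[1,0]] = TL.map (fun x => x.1.take 4) := by decide +kernel

set_option maxRecDepth 100000 in
lemma dfs2 : lev 8 [[0,1,2,3]] = [[0,1,2,3,4,5,6,7,8,9,10,11]] := by decide +kernel

lemma perm_ext (g g' : Perm (Fin 12)) (h : vals g 12 = vals g' 12) : g = g' := by
  ext i
  have := congrArg (fun l => l.getD i 0) h
  simpa [vals, gv] using this

lemma pres_one : pres 1 := fun S hS => ⟨S, hS, fun _ => rfl⟩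

lemma pres_mul {a b : Perm (Fin 12)} (ha : pres a) (hb : pres b) : pres (a * b) := by
  intro S hS
  obtain ⟨S1, h1, e1⟩ := hb S hS
  obtain ⟨S2, h2, e2⟩ := ha S1 h1
  exact ⟨S2, h2, fun i => by rw [e1, e2]; rfl⟩

lemma pres_pow {a : Perm (Fin 12)} (ha : pres a) (n : ℕ) : pres (a ^ n) := by
  induction n with
  | zero => exact pres_one
  | succ n ih => rw [pow_succ]; exact pres_mul ih ha

lemma pres_inv {a : Perm (Fin 12)} (ha : pres a) : pres a⁻¹ := by
  have h : a⁻¹ = a ^ (orderOf a - 1) := by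
    rw [inv_eq_iff_mul_eq_one, ← pow_succ', Nat.sub_add_cancel (orderOf_pos a), pow_orderOf_eq_one]
  rw [h]; exact pres_pow ha _

def MM : Subgroup (Perm (Fin 12)) where
  carrier := {g | pres g}
  mul_mem' := pres_mul
  one_mem' := pres_one
  inv_mem' := pres_inv

def sigma : Perm (Fin 12) where
  toFun := Fin.cases 0 (fun x : Fin 11 => (x + 1).succ)
  invFun := Fin.cases 0 (fun x : Fin 11 => (x - 1).succ)
  left_inv := by decide
  right_inv := by decide

noncomputable def tauP : Perm (Fin 12) :=
  Equiv.ofBijective (fun i => Fin.ofNat 12 (tau0.getD i 0))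
    (Finite.injective_iff_bijective.1 (by decide))

noncomputable def yP : Perm (Fin 12) :=
  Equiv.ofBijective (Fin.cases 0 (fun x : Fin 11 => (3 * x).succ))
    (Finite.injective_iff_bijective.1 (by decide))

noncomputable def nuP : Perm (Fin 12) :=
  Equiv.ofBijective (Fin.cases 0 (fun x : Fin 11 => (- x).succ))
    (Finite.injective_iff_bijective.1 (by decide))

def cmp (u v : List ℕ) : List ℕ := v.map (fun i => u.getD i 0)

lemma gv_eq (g : Perm (Fin 12)) (i : ℕ) (h : i < 12) : (vals g 12).getD i 0 = gv g i := by
  simp [vals, h]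

lemma vals_mul (a b : Perm (Fin 12)) : vals (a * b) 12 = cmp (vals a 12) (vals b 12) := by
  unfold cmp
  conv_lhs => unfold vals
  conv_rhs => rw [vals.eq_def b]
  rw [List.map_map]
  apply List.map_congr_left
  intro i hi
  rw [List.mem_range] at hi
  rw [Function.comp, gv_eq _ _ (gv_lt b i)]
  simp [gv, hi]

def sl1 : List ℕ := [0,2,3,4,5,6,7,8,9,10,11,1]
def sl : ℕ → List ℕ
  | 0 => List.range 12
  | n+1 => cmp sl1 (sl n)

lemma vals_sigma : vals sigma 12 = sl1 := by decide
lemma vals_tau : vals tauP 12 = tau0 := by decide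

lemma vals_pow (n : ℕ) : vals (sigma ^ n) 12 = sl n := by
  induction n with
  | zero => decide
  | succ n ih => rw [pow_succ', vals_mul, ih, vals_sigma]; rfl

noncomputable def wP (τ : Perm (Fin 12)) : List ℕ → Perm (Fin 12)
  | [] => 1
  | x :: r => if r = [] then sigma ^ x else sigma ^ x * τ * wP τ r

def wL (τ : List ℕ) : List ℕ → List ℕ
  | [] => List.range 12
  | x :: r => if r = [] then sl x else cmp (cmp (sl x) τ) (wL τ r)

lemma vals_wP (τ : Perm (Fin 12)) (l : List ℕ) : vals (wP τ l) 12 = wL (vals τ 12) l := by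
  induction l with
  | nil => simp only [wP, wL]; decide
  | cons x r ih =>
    simp only [wP, wL]
    split_ifs
    · exact vals_pow x
    · rw [vals_mul, vals_mul, vals_pow, ih]

lemma wP_mem (K : Subgroup (Perm (Fin 12))) (hs : sigma ∈ K) (τ : Perm (Fin 12)) (ht : τ ∈ K)
    (l : List ℕ) : wP τ l ∈ K := by
  induction l with
  | nil => exact K.one_mem
  | cons x r ih =>
    simp only [wP]
    split_ifs
    · exact K.pow_mem hs x
    · exact K.mul_mem (K.mul_mem (K.pow_mem hs x) ht) ih

set_option maxRecDepth 100000 in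
lemma TL_words : ∀ e ∈ TL, wL e.1 e.2.1 = tau0 ∧ wL tau0 e.2.2 = e.1 := by decide +kernel

set_option maxRecDepth 100000 in
lemma TL_head : ∀ e ∈ TL, e.1.take 2 = [1,0] := by decide +kernel

lemma pres_of_list (g : Perm (Fin 12)) (h : consB (vals g 12) = true) : pres g := by
  intro S hS
  unfold consB at h
  rw [List.all_eq_true] at h
  have := h S hS
  rw [List.any_eq_true] at this
  obtain ⟨S', hS', h⟩ := this
  refine ⟨S', hS', ?_⟩
  have key : ∀ (n i : ℕ), i + n ≤ 12 → chk S S' i ((List.range' i n).map (gv g)) = true →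
      ∀ j (hj : j < 12), i ≤ j → j < i + n → S.testBit j = S'.testBit (gv g j) := by
    intro n
    induction n with
    | zero => intro i _ _ j hj h1 h2; omega
    | succ n ih =>
      intro i hi hc j hj h1 h2
      simp only [List.range'_succ, List.map_cons, chk, Bool.and_eq_true, beq_iff_eq] at hc
      rcases Nat.eq_or_lt_of_le h1 with h3 | h3
      · subst h3; exact hc.1
      · exact ih (i+1) (by omega) hc.2 j hj h3 (by omega)
  intro i
  have := key 12 0 (by omega) (by rwa [← List.range_eq_range']) i i.2 (by omega) (by omega)
  simpa [gv] using this

lemma sigma_MM : sigma ∈ MM := pres_of_list _ (by rw [vals_sigma]; decide +kernel)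
lemma tau_MM : tauP ∈ MM := pres_of_list _ (by rw [vals_tau]; decide +kernel)
lemma vals_y : vals yP 12 = [0,1,4,7,10,2,5,8,11,3,6,9] := by decide
lemma y_MM : yP ∈ MM := pres_of_list _ (by rw [vals_y]; decide +kernel)

lemma y_rel : yP * sigma = sigma ^ 3 * yP := by
  apply perm_ext
  rw [vals_mul, vals_mul, vals_pow, vals_sigma, vals_y]; decide

lemma take_vals (g : Perm (Fin 12)) : (vals g 12).take 4 = vals g 4 := by
  simp [vals, ← List.map_take, List.take_range]

lemma vals_eq_vals {g g' : Perm (Fin 12)} {k : ℕ} (hk : k ≤ 12) (h : vals g k = vals g' k) (i : Fin 12)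
    (hi : i.val < k) : g i = g' i := by
  have := congrArg (fun l => l.getD i 0) h
  simp [vals, gv, hi] at this
  exact Fin.ext this

/-- elements of `MM` swapping the first two points are in the list -/
lemma T_mem (g : Perm (Fin 12)) (hg : g ∈ MM) (h0 : g 0 = 1) (h1 : g 1 = 0) :
    ∃ e ∈ TL, vals g 12 = e.1 := by
  have hv2 : vals g 2 = [1,0] := by
    have a : gv g 0 = 1 := by simp [gv, h0]
    have b : gv g 1 = 0 := by simp [gv, h1]
    simp [vals, List.range_succ, a, b]
  have h4 := lev_mem g hg 2 2 [[1,0]] (by omega) (by rw [hv2]; simp)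
  rw [dfs1, List.mem_map] at h4
  obtain ⟨e, he, h4⟩ := h4
  refine ⟨e, he, ?_⟩
  set k := wP tauP e.2.2 with hk
  have hkM : k ∈ MM := wP_mem MM sigma_MM tauP tau_MM _
  have hkv : vals k 12 = e.1 := by rw [hk, vals_wP, vals_tau]; exact (TL_words e he).2
  rw [← hkv, take_vals] at h4
  have hm : k⁻¹ * g ∈ MM := MM.mul_mem (MM.inv_mem hkM) hg
  have hfix : ∀ i : Fin 12, i.val < 4 → (k⁻¹ * g) i = i := by
    intro i hi
    rw [Perm.mul_apply, ← vals_eq_vals (by omega) h4 i hi]; simp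
  have hv4 : vals (k⁻¹ * g) 4 = [0,1,2,3] := by
    have a : gv (k⁻¹ * g) 0 = 0 := by
      have := hfix 0 (by decide); simp only [gv]; simp [-Perm.coe_mul, this]
    have b : gv (k⁻¹ * g) 1 = 1 := by
      have := hfix 1 (by decide); simp only [gv]; simp [-Perm.coe_mul, this]
    have c : gv (k⁻¹ * g) 2 = 2 := by
      have := hfix 2 (by decide)
      simp only [gv]
      rw [dif_pos (by norm_num)]
      exact congrArg Fin.val this
    have d : gv (k⁻¹ * g) 3 = 3 := by
      have := hfix 3 (by decide)
      simp only [gv]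
      rw [dif_pos (by norm_num)]
      exact congrArg Fin.val this
    simp [vals, List.range_succ, a, b, c, d]
  have h12 := lev_mem _ hm 8 4 [[0,1,2,3]] (by omega) (by rw [hv4]; simp)
  rw [dfs2, List.mem_singleton] at h12
  have : k⁻¹ * g = 1 := by
    apply perm_ext
    rw [h12]; decide
  have : g = k := by
    have := congrArg (k * ·) this
    simpa using this
  rw [this, hkv]

/-- Theorem F -/
lemma thmF (K : Subgroup (Perm (Fin 12))) (hK : K ≤ MM) (hs : sigma ∈ K)
    (hg : ∃ g ∈ K, g 0 ≠ 0) : MM ≤ K := by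
  have sig_to : ∀ a : Fin 12, a ≠ 0 → ∃ s ∈ K, s 0 = 0 ∧ s a = 1 := by
    have h : ∀ a : Fin 12, a ≠ 0 → ∃ n : Fin 11, (sigma ^ n.val) 0 = 0 ∧ (sigma ^ n.val) a = 1 := by
      decide
    intro a ha
    obtain ⟨n, h1, h2⟩ := h a ha
    exact ⟨_, K.pow_mem hs n, h1, h2⟩
  have norm : ∀ g : Perm (Fin 12), g 0 ≠ 0 → ∃ a ∈ K, ∃ b ∈ K, (a * g * b) 0 = 1 ∧ (a * g * b) 1 = 0 := by
    intro g hg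
    obtain ⟨s, hs1, hs2, hs3⟩ := sig_to (g 0) hg
    have : g⁻¹ 0 ≠ 0 := by
      intro h
      apply hg
      rw [Perm.inv_eq_iff_eq] at h
      exact h.symm
    obtain ⟨r, hr1, hr2, hr3⟩ := sig_to (g⁻¹ 0) this
    refine ⟨s, hs1, r⁻¹, K.inv_mem hr1, ?_, ?_⟩
    · have : r⁻¹ 0 = 0 := by rw [Perm.inv_eq_iff_eq, hr2]
      simp only [Perm.mul_apply, this, hs3]
    · have : r⁻¹ 1 = g⁻¹ 0 := by rw [Perm.inv_eq_iff_eq, hr3]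
      simp [Perm.mul_apply, this, hs2]
  -- tau0 in K
  obtain ⟨g, hgK, hg0⟩ := hg
  obtain ⟨a, ha, b, hb, e1, e2⟩ := norm g hg0
  have hmem := K.mul_mem (K.mul_mem ha hgK) hb
  obtain ⟨e, he, hv⟩ := T_mem _ (hK hmem) e1 e2
  have htau : tauP ∈ K := by
    have h1 : wP (a * g * b) e.2.1 = tauP := by
      apply perm_ext
      rw [vals_wP, hv, vals_tau]; exact (TL_words e he).1
    rw [← h1]; exact wP_mem K hs _ hmem _
  have hT : ∀ k ∈ MM, k 0 = 1 → k 1 = 0 → k ∈ K := by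
    intro k hk k0 k1
    obtain ⟨e, he, hv⟩ := T_mem k hk k0 k1
    have h1 : wP tauP e.2.2 = k := by
      apply perm_ext
      rw [vals_wP, hv, vals_tau]; exact (TL_words e he).2
    rw [← h1]; exact wP_mem K hs _ htau _
  have hN : ∀ k ∈ MM, k 0 ≠ 0 → k ∈ K := by
    intro k hk k0
    obtain ⟨a, ha, b, hb, e1, e2⟩ := norm k k0
    have := hT _ (MM.mul_mem (MM.mul_mem (hK ha) hk) (hK hb)) e1 e2
    have h2 : k = a⁻¹ * (a * k * b) * b⁻¹ := by group
    rw [h2]; exact K.mul_mem (K.mul_mem (K.inv_mem ha) this) (K.inv_mem hb)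
  intro k hk
  by_cases k0 : k 0 = 0
  · have h3 : (g * k) 0 ≠ 0 := by rw [Perm.mul_apply, k0]; exact hg0
    have := hN _ (MM.mul_mem (hK hgK) hk) h3
    have h2 : k = g⁻¹ * (g * k) := by group
    rw [h2]; exact K.mul_mem (K.inv_mem hgK) this
  · exact hN k hk k0

def TwoTr (H : Subgroup (Perm (Fin 12))) : Prop :=
  ∀ a b c d : Fin 12, a ≠ b → c ≠ d → ∃ g ∈ H, g a = c ∧ g b = d

lemma orbit_pair (H : Subgroup (Perm (Fin 12))) (h2 : TwoTr H) :
    Nat.card (MulAction.orbit H ((0, 1) : Fin 12 × Fin 12)) = 132 := by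
  have : MulAction.orbit H ((0, 1) : Fin 12 × Fin 12) =
      ((Finset.univ.filter (fun p : Fin 12 × Fin 12 => p.1 ≠ p.2) : Finset _) : Set _) := by
    ext ⟨c, d⟩
    simp only [MulAction.mem_orbit_iff, Finset.coe_filter, Finset.mem_univ, true_and,
      Set.mem_ofPred_eq]
    constructor
    · rintro ⟨⟨g, hg⟩, h⟩
      have h1 : g 0 = c := congrArg Prod.fst h
      have h2 : g 1 = d := congrArg Prod.snd h
      rw [← h1, ← h2]
      intro h3
      have := g.injective h3
      exact absurd this (by decide)
    · intro hcd
      obtain ⟨g, hg, h3, h4⟩ := h2 0 1 c d (by decide) hcd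
      exact ⟨⟨g, hg⟩, Prod.ext h3 h4⟩
  rw [this, Nat.card_coe_set_eq, Set.ncard_coe_finset]
  decide +kernel

lemma card_orbit (H : Subgroup (Perm (Fin 12))) (h2 : TwoTr H) :
    Nat.card H = 132 * Nat.card (MulAction.stabilizer H ((0, 1) : Fin 12 × Fin 12)) := by
  have := Nat.card_congr (MulAction.orbitProdStabilizerEquivGroup H ((0, 1) : Fin 12 × Fin 12))
  rw [Nat.card_prod, orbit_pair H h2] at this
  exact this.symm

set_option maxRecDepth 100000 in
lemma TL_nodup : (TL.map (fun e => e.1)).Nodup := by decide +kernel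

lemma card_MM (h2 : TwoTr MM) : Nat.card MM = 7920 := by
  rw [card_orbit MM h2]
  suffices h : Nat.card (MulAction.stabilizer MM ((0, 1) : Fin 12 × Fin 12)) = 60 by rw [h]
  have hlen : (TL.map (fun e => e.1)).toFinset.card = 60 := by
    rw [List.toFinset_card_of_nodup TL_nodup]; rfl
  rw [← hlen, ← Set.ncard_coe_finset, ← Nat.card_coe_set_eq]
  have t0 : tauP 0 = 1 := by decide
  have t1 : tauP 1 = 0 := by decide
  have f (s : MulAction.stabilizer MM ((0, 1) : Fin 12 × Fin 12)) :
      (s.1.1 0 = 0 ∧ s.1.1 1 = 1) := by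
    have := s.2
    rw [MulAction.mem_stabilizer_iff] at this
    exact ⟨congrArg Prod.fst this, congrArg Prod.snd this⟩
  refine Nat.card_congr (Equiv.ofBijective
    (fun s => ⟨vals (tauP * s.1.1) 12, ?_⟩) ⟨?_, ?_⟩)
  · obtain ⟨e, he, hv⟩ := T_mem (tauP * s.1.1) (MM.mul_mem tau_MM s.1.2)
      (by rw [Perm.mul_apply, (f s).1, t0]) (by rw [Perm.mul_apply, (f s).2, t1])
    rw [Finset.mem_coe, List.mem_toFinset, List.mem_map]
    exact ⟨e, he, hv.symm⟩
  · intro s s' h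
    have := perm_ext _ _ (congrArg Subtype.val h)
    exact Subtype.ext (Subtype.ext (mul_left_cancel this))
  · rintro ⟨l, hl⟩
    rw [Finset.mem_coe, List.mem_toFinset, List.mem_map] at hl
    obtain ⟨e, he, rfl⟩ := hl
    have hkM : wP tauP e.2.2 ∈ MM := wP_mem MM sigma_MM tauP tau_MM _
    have hkv : vals (wP tauP e.2.2) 12 = e.1 := by rw [vals_wP, vals_tau]; exact (TL_words e he).2
    set k := wP tauP e.2.2
    have hh := TL_head e he
    rw [← hkv] at hh
    have hh2 : vals k 2 = vals tauP 2 := by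
      have a : (vals k 12).take 2 = vals k 2 := by simp [vals, ← List.map_take, List.take_range]
      rw [← a, hh]; decide
    have k0 : k 0 = 1 := by rw [vals_eq_vals (by omega) hh2 0 (by decide), t0]
    have k1 : k 1 = 0 := by rw [vals_eq_vals (by omega) hh2 1 (by decide), t1]
    refine ⟨⟨⟨tauP⁻¹ * k, MM.mul_mem (MM.inv_mem tau_MM) hkM⟩, ?_⟩, ?_⟩
    · rw [MulAction.mem_stabilizer_iff]
      apply Prod.ext
      · change (tauP⁻¹ * k) 0 = 0
        rw [Perm.mul_apply, k0, Perm.inv_eq_iff_eq, t0]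
      · change (tauP⁻¹ * k) 1 = 1
        rw [Perm.mul_apply, k1, Perm.inv_eq_iff_eq, t1]
    · apply Subtype.ext
      change vals (tauP * (tauP⁻¹ * k)) 12 = _
      rw [mul_inv_cancel_left, hkv]

lemma sigma11 : sigma ^ 11 = 1 := by
  apply perm_ext
  rw [vals_pow]; decide

lemma simple_MM (h2 : TwoTr MM) : IsSimpleGroup MM := by
  have hnt : Nontrivial MM := by
    refine ⟨⟨⟨sigma, sigma_MM⟩, 1, ?_⟩⟩
    intro h
    have h' : sigma = 1 := congrArg Subtype.val h
    have : sigma 1 = 1 := by rw [h']; rfl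
    exact absurd this (by decide)
  refine { hnt with eq_bot_or_eq_top_of_normal := ?_ }
  intro N hN
  by_cases hb : N = ⊥
  · exact Or.inl hb
  right
  obtain ⟨⟨⟨g, hgM⟩, hgN⟩, hg1'⟩ := Subgroup.ne_bot_iff_exists_ne_one.1 hb
  have hg1 : (⟨g, hgM⟩ : MM) ≠ 1 := fun h => hg1' (Subtype.ext h)
  have hmv : ∃ c, g c ≠ c := by
    by_contra hcon
    push Not at hcon
    exact hg1 (Subtype.ext (Equiv.ext hcon))
  obtain ⟨c, hc⟩ := hmv
  obtain ⟨k, hk, hk1, hk2⟩ := h2 c (g c) 0 1 (Ne.symm hc) (by decide)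
  have hN' : ∃ u ∈ N, u.1 0 ≠ 0 := by
    refine ⟨_, hN.conj_mem _ hgN ⟨k, hk⟩, ?_⟩
    have hki : k⁻¹ 0 = c := by rw [Perm.inv_eq_iff_eq, hk1]
    change k (g (k⁻¹ 0)) ≠ 0
    rw [hki, hk2]; decide
  obtain ⟨u, huN, hu0⟩ := hN'
  let s : MM := ⟨sigma, sigma_MM⟩
  let y : MM := ⟨yP, y_MM⟩
  -- general consequence of thmF
  have gen : ∀ K : Subgroup MM, s ∈ K → u ∈ K → K = ⊤ := by
    intro K hsK huK
    have := thmF (K.map MM.subtype) (by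
      rintro _ ⟨a, _, rfl⟩; exact a.2) ⟨s, hsK, rfl⟩ ⟨u.1, ⟨u, huK, rfl⟩, hu0⟩
    rw [eq_top_iff]
    intro a _
    obtain ⟨b, hb, hba⟩ := this a.2
    have : b = a := Subtype.ext hba
    exact this ▸ hb
  have h1 : N ⊔ Subgroup.zpowers s = ⊤ :=
    gen _ (Subgroup.mem_sup_right (Subgroup.mem_zpowers s)) (Subgroup.mem_sup_left huN)
  have hy : y ∈ N ⊔ Subgroup.zpowers s := by rw [h1]; trivial
  rw [Subgroup.mem_sup_of_normal_left] at hy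
  obtain ⟨n, hn, z, hz, hnz⟩ := hy
  obtain ⟨i, rfl⟩ := hz
  have hrel : y * s = s ^ 3 * y := Subtype.ext y_rel
  have hns : n * s = s ^ 3 * n := by
    rw [← hnz] at hrel
    have hcomm : s ^ i * s = s * s ^ i := (Commute.zpow_self s i).eq
    change n * s ^ i * s = s ^ 3 * (n * s ^ i) at hrel
    rw [mul_assoc, hcomm, ← mul_assoc, ← mul_assoc] at hrel
    exact mul_right_cancel hrel
  have hs2 : s ^ 2 ∈ N := by
    have e : s ^ 2 = n * (s * n⁻¹ * s⁻¹) := by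
      have : n * (s * n⁻¹ * s⁻¹) = (n * s) * n⁻¹ * s⁻¹ := by group
      rw [this, hns]; group
    rw [e]
    exact N.mul_mem hn (hN.conj_mem _ (N.inv_mem hn) s)
  have hs : s ∈ N := by
    have e : s = (s ^ 2) ^ 6 := by
      have h11 : s ^ 11 = 1 := Subtype.ext sigma11
      rw [← pow_mul, show 2 * 6 = 11 + 1 by norm_num, pow_succ, h11, one_mul]
    rw [e]; exact N.pow_mem hs2 6
  exact gen N hs huN

structure Good (H : Subgroup (Perm (Fin 12))) (B : Finset (Fin 12 → Bool)) : Prop where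
  two : TwoTr H
  ne : B.Nonempty
  card : B.card ≤ 43
  six : ∀ f ∈ B, (Finset.univ.filter (fun i => f i = true)).card = 6
  compl : ∀ f ∈ B, (fun i => !(f i)) ∈ B
  act : ∀ g ∈ H, ∀ f ∈ B, (fun i => f (g i)) ∈ B

lemma Good.conj {H : Subgroup (Perm (Fin 12))} {B : Finset (Fin 12 → Bool)} (h : Good H B)
    (π : Perm (Fin 12)) :
    Good (H.map (MulAut.conj π).toMonoidHom) (B.image (fun f i => f (π⁻¹ i))) where
  two := by
    intro a b c d hab hcd
    obtain ⟨g, hg, h1, h2⟩ := h.two (π⁻¹ a) (π⁻¹ b) (π⁻¹ c) (π⁻¹ d)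
      (fun e => hab (π⁻¹.injective e)) (fun e => hcd (π⁻¹.injective e))
    refine ⟨π * g * π⁻¹, ⟨g, hg, rfl⟩, ?_, ?_⟩
    · simp only [Perm.mul_apply, h1]; simp
    · simp only [Perm.mul_apply, h2]; simp
  ne := h.ne.image _
  card := Finset.card_image_le.trans h.card
  six := by
    intro f hf
    rw [Finset.mem_image] at hf
    obtain ⟨f, hf, rfl⟩ := hf
    rw [← h.six f hf]
    apply Finset.card_bij' (fun i _ => π⁻¹ i) (fun i _ => π i)
    · intro i hi; simpa using hi
    · intro i hi; simpa using hi
    · intro i _; simp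
    · intro i _; simp
  compl := by
    intro f hf
    rw [Finset.mem_image] at hf ⊢
    obtain ⟨f, hf, rfl⟩ := hf
    exact ⟨_, h.compl f hf, rfl⟩
  act := by
    rintro _ ⟨g, hg, rfl⟩ f hf
    rw [Finset.mem_image] at hf ⊢
    obtain ⟨f, hf, rfl⟩ := hf
    refine ⟨_, h.act g hg f hf, ?_⟩
    funext i
    change f (g (π⁻¹ i)) = f (π⁻¹ ((π * g * π⁻¹) i))
    simp [Perm.mul_apply]

def bf (m : ℕ) : Fin 12 → Bool := fun i => m.testBit i

def DN : List ℕ := [474, 948, 1142, 1678, 1896, 2284, 2618, 2886, 3356, 3490, 3792]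

def Phi (f : Fin 12 → Bool) (p : Fin 11 × Bool) : Fin 12 → Bool :=
  fun x => xor p.2 (f ((sigma ^ p.1.val) x))

lemma sig0 : ∀ i : Fin 11, (sigma ^ i.val) 0 = 0 := by decide
lemma sigS : ∀ i j : Fin 11, (sigma ^ i.val) j.succ = (j + i).succ := by decide

lemma Phi_inj (f : Fin 12 → Bool) (h0 : f 0 = false)
    (h6 : (Finset.univ.filter (fun i => f i = true)).card = 6) :
    Function.Injective (Phi f) := by
  rintro ⟨i, ε⟩ ⟨j, δ⟩ h
  have e0 := congrFun h 0
  simp only [Phi, sig0, h0, Bool.xor_false] at e0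
  subst e0
  have e1 : ∀ x : Fin 11, f (x + i).succ = f (x + j).succ := by
    intro x
    have := congrFun h x.succ
    simpa only [Phi, sigS, Bool.xor_right_inj] using this
  by_cases hij : i = j
  · rw [hij]
  exfalso
  have e2 : ∀ x : Fin 11, f (x + (j - i)).succ = f x.succ := by
    intro x
    have := e1 (x - i)
    rw [sub_add_cancel] at this
    rw [this, sub_add_eq_add_sub, add_sub_assoc]
  have e3 : ∀ (n : ℕ) (x : Fin 11), f (x + n • (j - i)).succ = f x.succ := by
    intro n
    induction n with
    | zero => intro x; simp
    | succ n ih => intro x; rw [succ_nsmul, ← add_assoc, e2, ih]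
  have e4 : ∀ k : Fin 11, k ≠ 0 → ∀ x : Fin 11, ∃ n : Fin 11, 0 + n.val • k = x := by decide
  have e5 : ∀ x : Fin 11, f x.succ = f (0 : Fin 11).succ := by
    intro x
    obtain ⟨n, hn⟩ := e4 (j - i) (sub_ne_zero.2 (Ne.symm hij)) x
    rw [← hn, e3]
  rw [Finset.card_filter, Fin.sum_univ_succ, h0] at h6
  simp only [e5] at h6
  simp at h6
  split_ifs at h6
  omega

lemma Phi_mem {H : Subgroup (Perm (Fin 12))} {B : Finset (Fin 12 → Bool)} (h : Good H B)
    (hs : sigma ∈ H) (f) (hf : f ∈ B) (p) : Phi f p ∈ B := by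
  obtain ⟨i, ε⟩ := p
  have := h.act _ (H.pow_mem hs i.val) f hf
  cases ε
  · have e : Phi f (i, false) = fun x => f ((sigma ^ i.val) x) := by funext x; simp [Phi]
    rw [e]; exact this
  · have e : Phi f (i, true) = fun x => !(f ((sigma ^ i.val) x)) := by funext x; simp [Phi]
    rw [e]; exact h.compl _ this

lemma exists_f0 {H : Subgroup (Perm (Fin 12))} {B : Finset (Fin 12 → Bool)} (h : Good H B) :
    ∃ f ∈ B, f 0 = false := by
  obtain ⟨f, hf⟩ := h.ne
  rcases h0 : f 0 with _ | _
  · exact ⟨f, hf, h0⟩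
  · exact ⟨_, h.compl f hf, by simp [h0]⟩

lemma Phi_Phi (f : Fin 12 → Bool) (p : Fin 11 × Bool) (i : Fin 11) (ε : Bool) :
    Phi (Phi f p) (i, ε) = Phi f (i + p.1, xor ε p.2) := by
  obtain ⟨k, δ⟩ := p
  funext x
  refine Fin.cases ?_ (fun y => ?_) x
  · simp [Phi, sig0]
  · simp [Phi, sigS, add_assoc]

lemma Phi_zero (f : Fin 12 → Bool) : Phi f (0, false) = f := by
  funext x; simp [Phi]

lemma B_eq {H : Subgroup (Perm (Fin 12))} {B : Finset (Fin 12 → Bool)} (h : Good H B)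
    (hs : sigma ∈ H) (f) (hf : f ∈ B) (hf0 : f 0 = false) :
    B = Finset.univ.image (Phi f) := by
  classical
  have sub : ∀ f ∈ B, Finset.univ.image (Phi f) ⊆ B := by
    intro f hf b hb
    rw [Finset.mem_image] at hb
    obtain ⟨p, _, rfl⟩ := hb
    exact Phi_mem h hs f hf p
  have crd : ∀ f ∈ B, f 0 = false → (Finset.univ.image (Phi f)).card = 22 := by
    intro f hf h0
    rw [Finset.card_image_of_injective _ (Phi_inj f h0 (h.six f hf))]; rfl
  apply Finset.Subset.antisymm _ (sub f hf)
  by_contra hcon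
  have : ∃ f' ∈ B, f' 0 = false ∧ f' ∉ Finset.univ.image (Phi f) := by
    rw [Finset.not_subset] at hcon
    obtain ⟨b, hb, hnb⟩ := hcon
    rcases h0 : b 0 with _ | _
    · exact ⟨b, hb, h0, hnb⟩
    · refine ⟨_, h.compl b hb, by simp [h0], ?_⟩
      intro hm
      apply hnb
      rw [Finset.mem_image] at hm ⊢
      obtain ⟨p, _, hp⟩ := hm
      refine ⟨(p.1, !p.2), Finset.mem_univ _, ?_⟩
      funext x
      have := congrFun hp x
      simp only [Phi] at this ⊢
      rw [Bool.not_xor, this, Bool.not_not]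
  obtain ⟨f', hf', h0', hn'⟩ := this
  have hd : Disjoint (Finset.univ.image (Phi f)) (Finset.univ.image (Phi f')) := by
    rw [Finset.disjoint_left]
    intro b hb hb'
    rw [Finset.mem_image] at hb hb'
    obtain ⟨p, _, hp⟩ := hb
    obtain ⟨⟨j, δ⟩, _, hp'⟩ := hb'
    apply hn'
    rw [Finset.mem_image]
    refine ⟨(-j + p.1, xor δ p.2), Finset.mem_univ _, ?_⟩
    rw [← Phi_Phi, hp, ← hp', Phi_Phi]
    simp [Phi_zero]
  have := Finset.card_le_card (Finset.union_subset (sub f hf) (sub f' hf'))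
  rw [Finset.card_union_of_disjoint hd, crd f hf hf0, crd f' hf' h0'] at this
  have := h.card
  omega

def cnt (B : Finset (Fin 12 → Bool)) (a b : Fin 12) : ℕ :=
  (B.filter (fun f => f a = true ∧ f b = true)).card

lemma cnt_eq {H : Subgroup (Perm (Fin 12))} {B : Finset (Fin 12 → Bool)} (h : Good H B)
    (a b c d : Fin 12) (hab : a ≠ b) (hcd : c ≠ d) : cnt B a b = cnt B c d := by
  obtain ⟨g, hg, h1, h2⟩ := h.two a b c d hab hcd
  unfold cnt
  apply Finset.card_bij' (fun f _ => fun i => f (g⁻¹ i)) (fun f _ => fun i => f (g i))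
  · intro f hf
    simp only [Finset.mem_filter] at hf ⊢
    refine ⟨h.act _ (H.inv_mem hg) f hf.1, ?_, ?_⟩
    · rw [← h1]; simpa using hf.2.1
    · rw [← h2]; simpa using hf.2.2
  · intro f hf
    simp only [Finset.mem_filter] at hf ⊢
    exact ⟨h.act _ hg f hf.1, by rw [h1]; exact hf.2.1, by rw [h2]; exact hf.2.2⟩
  · intro f _; funext i; simp
  · intro f _; funext i; simp

lemma cnt_Phi (f : Fin 12 → Bool) (h0 : f 0 = false)
    (h6 : (Finset.univ.filter (fun i => f i = true)).card = 6) (a b : Fin 12) :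
    cnt (Finset.univ.image (Phi f)) a b =
      (Finset.univ.filter (fun p => Phi f p a = true ∧ Phi f p b = true)).card := by
  unfold cnt
  rw [Finset.filter_image, Finset.card_image_of_injective _ (Phi_inj f h0 h6)]

lemma split_cnt (P : Fin 11 × Bool → Prop) [DecidablePred P] :
    (Finset.univ.filter P).card = (Finset.univ.filter (fun i => P (i, true))).card +
      (Finset.univ.filter (fun i => P (i, false))).card := by
  simp only [Finset.card_filter]
  rw [Fintype.sum_prod_type, ← Finset.sum_add_distrib]
  apply Finset.sum_congr rfl
  intro i _
  rw [Fintype.sum_bool]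

lemma ds (f : Fin 12 → Bool) (h0 : f 0 = false)
    (h6 : (Finset.univ.filter (fun i => f i = true)).card = 6)
    (hc : ∀ a b c d : Fin 12, a ≠ b → c ≠ d → cnt (Finset.univ.image (Phi f)) a b =
      cnt (Finset.univ.image (Phi f)) c d) (d : Fin 11) (hd : d ≠ 0) :
    (Finset.univ.filter (fun i : Fin 11 => f i.succ = f (i + d).succ)).card = 5 := by
  have h6' : (Finset.univ.filter (fun i : Fin 11 => f i.succ = false)).card = 5 := by
    rw [Finset.card_filter, Fin.sum_univ_succ, h0] at h6
    simp only [Bool.false_eq_true, if_false, zero_add] at h6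
    rw [← Finset.card_filter] at h6
    have := Finset.card_filter_add_card_filter_not (s := (Finset.univ : Finset (Fin 11))) (fun i : Fin 11 => f i.succ = true)
    rw [h6] at this
    simp only [Bool.not_eq_true, Finset.card_univ, Fintype.card_fin] at this
    omega
  have e := hc 0 (0 : Fin 11).succ (0 : Fin 11).succ d.succ (by decide)
    (by intro h; exact hd (Fin.succ_injective _ h).symm)
  rw [cnt_Phi f h0 h6, cnt_Phi f h0 h6, split_cnt, split_cnt] at e
  simp only [Phi, sig0, sigS, h0] at e
  simp at e
  rw [h6'] at e
  rw [e]
  simp only [Finset.card_filter]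
  rw [← Finset.sum_add_distrib]
  apply Finset.sum_congr rfl
  intro i _
  rw [add_comm i d]
  rcases f i.succ with _ | _ <;> rcases f (d + i).succ with _ | _ <;> simp

set_option maxRecDepth 100000 in
lemma ds_check : ∀ m : Fin 2048,
    ((List.finRange 11).filter (fun i => m.val.testBit i.val = false)).length = 5 →
    (∀ d ∈ ([1,2,3,4,5] : List (Fin 11)), ((List.finRange 11).filter
      (fun i => m.val.testBit i.val = m.val.testBit (i + d).val)).length = 5) →
    2 * m.val ∈ DD ∨ 2 * m.val ∈ DN := by decide +kernel

def Phi' (f : Fin 12 → Bool) (p : Fin 11 × Bool) : Fin 12 → Bool :=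
  Fin.cases (xor p.2 (f 0)) (fun y => xor p.2 (f (y + p.1).succ))

lemma Phi_eq (f : Fin 12 → Bool) (p : Fin 11 × Bool) : Phi f p = Phi' f p := by
  funext x
  refine Fin.cases ?_ (fun y => ?_) x
  · simp [Phi, Phi', sig0]
  · simp [Phi, Phi', sigS]

set_option maxRecDepth 100000 in
lemma fam_check : ∀ m ∈ DD, ∀ S ∈ DD, ∃ p : Fin 11 × Bool, bf S = Phi' (bf m) p := by
  decide +kernel

set_option maxRecDepth 100000 in
lemma fam_checkN : ∀ m ∈ DN, ∀ S ∈ DD, ∃ p : Fin 11 × Bool,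
    ∀ i : Fin 12, bf S (Fin.cases 0 (fun x : Fin 11 => (- x).succ) i) = Phi' (bf m) p i := by
  decide +kernel

set_option maxRecDepth 100000 in
lemma DD_nodup : (DD.map bf).Nodup := by decide +kernel

lemma fin1 {H : Subgroup (Perm (Fin 12))} {B : Finset (Fin 12 → Bool)} (h : Good H B)
    (hs : sigma ∈ H) (hD : ∀ S ∈ DD, bf S ∈ B) (hc : B.card = 22) : H = MM := by
  have hB : B = (DD.map bf).toFinset := by
    symm
    apply Finset.eq_of_subset_of_card_le
    · intro b hb
      rw [List.mem_toFinset, List.mem_map] at hb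
      obtain ⟨S, hS, rfl⟩ := hb
      exact hD S hS
    · rw [hc, List.toFinset_card_of_nodup DD_nodup]; rfl
  have hle : H ≤ MM := by
    intro g hg S hS
    have h1 := h.act _ (H.inv_mem hg) _ (hD S hS)
    rw [hB, List.mem_toFinset, List.mem_map] at h1
    obtain ⟨S', hS', e⟩ := h1
    refine ⟨S', hS', fun i => ?_⟩
    have := congrFun e (g i)
    simp only [bf] at this
    rw [this]; simp
  apply le_antisymm hle
  apply thmF H hle hs
  obtain ⟨g, hg, h1, -⟩ := h.two 0 1 1 0 (by decide) (by decide)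
  exact ⟨g, hg, by rw [h1]; decide⟩

lemma nu_app (i : Fin 12) : nuP i = Fin.cases 0 (fun x : Fin 11 => (- x).succ) i := rfl

lemma nu_sig : nuP * sigma⁻¹ * nuP⁻¹ = sigma := by
  rw [mul_inv_eq_iff_eq_mul, mul_inv_eq_iff_eq_mul]
  ext i
  revert i
  decide

lemma fin2 {H : Subgroup (Perm (Fin 12))} {B : Finset (Fin 12 → Bool)} (h : Good H B)
    (hs : sigma ∈ H) : ∃ π, H.map (MulAut.conj π).toMonoidHom = MM := by
  obtain ⟨f, hf, h0⟩ := exists_f0 h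
  have h6 := h.six f hf
  have hB := B_eq h hs f hf h0
  have hcard : B.card = 22 := by
    rw [hB, Finset.card_image_of_injective _ (Phi_inj f h0 h6)]; rfl
  have hds := ds f h0 h6 (by rw [← hB]; exact cnt_eq h)
  have h6' : (Finset.univ.filter (fun i : Fin 11 => f i.succ = false)).card = 5 := by
    rw [Finset.card_filter, Fin.sum_univ_succ, h0] at h6
    simp only [Bool.false_eq_true, if_false, zero_add] at h6
    rw [← Finset.card_filter] at h6
    have := Finset.card_filter_add_card_filter_not (s := (Finset.univ : Finset (Fin 11)))
      (fun i : Fin 11 => f i.succ = true)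
    rw [h6] at this
    simp only [Bool.not_eq_true, Finset.card_univ, Fintype.card_fin] at this
    omega
  let m : ℕ := Nat.ofBits (fun i : Fin 11 => f i.succ)
  have hm : ∀ i : Fin 11, m.testBit i.val = f i.succ := fun i => by
    simp [m, Nat.testBit_ofBits_lt]
  have hml : m < 2048 := Nat.ofBits_lt_two_pow _
  have hfm : f = bf (2 * m) := by
    funext x
    refine Fin.cases ?_ (fun y => ?_) x
    · simp [bf, h0]
    · rw [← hm y]
      simp [bf, Nat.testBit_succ]
  have key := ds_check ⟨m, hml⟩ (by simp only [hm]; exact h6') (by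
    intro d hd
    simp only [hm]
    exact hds d (by rintro rfl; exact absurd hd (by decide)))
  have hPhi : ∀ p, Phi' f p ∈ B := fun p => by rw [← Phi_eq]; exact Phi_mem h hs f hf p
  rcases key with key | key
  · refine ⟨1, ?_⟩
    have : H = MM := by
      apply fin1 h hs _ hcard
      intro S hS
      obtain ⟨p, hp⟩ := fam_check _ key S hS
      rw [hp, ← hfm]; exact hPhi p
    rw [this, map_one]
    exact Subgroup.map_id MM
  · refine ⟨nuP, fin1 (h.conj nuP) ⟨sigma⁻¹, H.inv_mem hs, nu_sig⟩ ?_ ?_⟩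
    · intro S hS
      obtain ⟨p, hp⟩ := fam_checkN _ key S hS
      rw [Finset.mem_image]
      refine ⟨Phi' f p, hPhi p, ?_⟩
      funext i
      have := hp (nuP⁻¹ i)
      rw [← nu_app, ← hfm] at this
      rw [← this]; simp
    · rw [Finset.card_image_of_injective, hcard]
      intro a b hab
      funext i
      have := congrFun hab (nuP i)
      simpa using this

lemma fin3 {H : Subgroup (Perm (Fin 12))} {B : Finset (Fin 12 → Bool)} (h : Good H B) :
    ∃ π, H.map (MulAut.conj π).toMonoidHom = MM := by
  have hdvd : 11 ∣ Nat.card H := by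
    rw [card_orbit H h.two]
    exact Dvd.dvd.mul_right (by norm_num) _
  have : Fact (Nat.Prime 11) := ⟨by norm_num⟩
  obtain ⟨⟨s, hs⟩, hord⟩ := exists_prime_orderOf_dvd_card' 11 hdvd
  have hord' : orderOf s = 11 := (Subgroup.orderOf_coe (⟨s, hs⟩ : H)).trans hord
  have hcyc : s.IsCycle := Perm.isCycle_of_prime_order' (by rw [hord']; norm_num)
    (by rw [hord']; simp)
  have hordσ : orderOf sigma = 11 := orderOf_eq_prime sigma11 (by
    intro h
    have : sigma 1 = 1 := by rw [h]; rfl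
    exact absurd this (by decide))
  have hcycσ : sigma.IsCycle := Perm.isCycle_of_prime_order' (by rw [hordσ]; norm_num)
    (by rw [hordσ]; simp)
  have hconj : IsConj s sigma := hcyc.isConj hcycσ (by
    rw [← hcyc.orderOf, ← hcycσ.orderOf, hord', hordσ])
  rw [isConj_iff] at hconj
  obtain ⟨π, hπ⟩ := hconj
  obtain ⟨ρ, hρ⟩ := fin2 (h.conj π) ⟨s, hs, hπ⟩
  refine ⟨ρ * π, ?_⟩
  rw [← hρ, Subgroup.map_map]
  congr 1

theorem final {H : Subgroup (Perm (Fin 12))} {B : Finset (Fin 12 → Bool)} (h : Good H B) :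
    IsSimpleGroup H ∧ Nat.card H = 7920 := by
  obtain ⟨π, hπ⟩ := fin3 h
  have h2 : TwoTr MM := by rw [← hπ]; exact (h.conj π).two
  have e : H ≃* MM := (H.equivMapOfInjective _ (MulAut.conj π).injective).trans
    (MulEquiv.subgroupCongr hπ)
  have := simple_MM h2
  refine ⟨e.isSimpleGroup, ?_⟩
  rw [Nat.card_congr e.toEquiv, card_MM h2]

end M11G
end

set_option linter.unusedSectionVars false
namespace Cert

def ladd : List ℤ → List ℤ → List ℤ
  | [], b => b
  | a :: l, [] => a :: l
  | a :: l, b :: m => (a + b) :: ladd l m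

def lsmul (c : ℤ) : List ℤ → List ℤ
  | [] => []
  | a :: l => (c * a) :: lsmul c l

def lmul : List ℤ → List ℤ → List ℤ
  | [], _ => []
  | a :: l, m => ladd (lsmul a m) (0 :: lmul l m)

def lneg : List ℤ → List ℤ
  | [] => []
  | a :: l => a :: lsmul (-1) (lneg l)

def lpow (a : List ℤ) : ℕ → List ℤ
  | 0 => [1]
  | n + 1 => lmul a (lpow a n)

def isZ : List ℤ → Bool
  | [] => true
  | a :: l => decide (a = 0) && isZ l

section
variable {S : Type*} [CommRing S]

def ev (z : S) : List ℤ → S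
  | [] => 0
  | a :: l => (a : S) + z * ev z l

theorem ev_ladd (z : S) : ∀ a b : List ℤ, ev z (ladd a b) = ev z a + ev z b
  | [], b => by simp [ladd, ev]
  | a :: l, [] => by simp [ladd, ev]
  | a :: l, b :: m => by simp only [ladd, ev, ev_ladd z l m]; push_cast; ring

theorem ev_lsmul (z : S) (c : ℤ) : ∀ a : List ℤ, ev z (lsmul c a) = c * ev z a
  | [] => by simp [lsmul, ev]
  | a :: l => by simp only [lsmul, ev, ev_lsmul z c l]; push_cast; ring

theorem ev_lmul (z : S) : ∀ a b : List ℤ, ev z (lmul a b) = ev z a * ev z b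
  | [], b => by simp [lmul, ev]
  | a :: l, b => by simp only [lmul, ev, ev_ladd, ev_lsmul, ev_lmul z l b]; push_cast; ring

theorem ev_lneg (z : S) : ∀ a : List ℤ, ev z (lneg a) = ev (-z) a
  | [] => by simp [lneg, ev]
  | a :: l => by simp only [lneg, ev, ev_lsmul, ev_lneg z l]; push_cast; ring

theorem ev_lpow (z : S) (a : List ℤ) : ∀ n, ev z (lpow a n) = ev z a ^ n
  | 0 => by simp [lpow, ev]
  | n + 1 => by simp only [lpow, ev_lmul, ev_lpow z a n]; ring

theorem ev_isZ (z : S) : ∀ a : List ℤ, isZ a = true → ev z a = 0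
  | [], _ => rfl
  | a :: l, h => by
    simp only [isZ, Bool.and_eq_true, decide_eq_true_eq] at h
    simp [ev, h.1, ev_isZ z l h.2]

theorem map_ev {T : Type*} [CommRing T] (φ : S →+* T) (z : S) :
    ∀ a : List ℤ, φ (ev z a) = ev (φ z) a
  | [] => by simp [ev]
  | a :: l => by simp [ev, map_ev φ z l]
end

abbrev E := List ℤ × List ℤ

def eadd (u v : E) : E := (ladd u.1 v.1, ladd u.2 v.2)
def esmul (c : ℤ) (u : E) : E := (lsmul c u.1, lsmul c u.2)
def eneg (u : E) : E := (lneg u.1, lsmul (-1) (lneg u.2))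
def emul (q : List ℤ) (u v : E) : E :=
  (ladd (lmul u.1 v.1) (lmul q (lmul u.2 v.2)), ladd (lmul u.1 v.2) (lmul u.2 v.1))
def epow (q : List ℤ) (u : E) : ℕ → E
  | 0 => ([1], [])
  | n + 1 => emul q u (epow q u n)
def eisZ (u : E) : Bool := isZ u.1 && isZ u.2

def xadd : List E → List E → List E
  | [], b => b
  | a :: l, [] => a :: l
  | a :: l, b :: m => eadd a b :: xadd l m
def xsmul (q : List ℤ) (c : E) : List E → List E
  | [] => []
  | a :: l => emul q c a :: xsmul q c l
def xmul (q : List ℤ) : List E → List E → List E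
  | [], _ => []
  | a :: l, m => xadd (xsmul q a m) (([], []) :: xmul q l m)
def xneg : List E → List E
  | [] => []
  | a :: l => eneg a :: xneg l
def xisZ : List E → Bool
  | [] => true
  | a :: l => eisZ a && xisZ l
/-- constant integer poly in x times e -/
def xof (e : E) : List ℤ → List E
  | [] => []
  | a :: l => esmul a e :: xof e l

section
variable {S : Type*} [CommRing S]

def evE (z w : S) (u : E) : S := ev z u.1 + w * ev z u.2

theorem evE_add (z w : S) (u v : E) : evE z w (eadd u v) = evE z w u + evE z w v := by
  simp only [evE, eadd, ev_ladd]; ring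
theorem evE_smul (z w : S) (c : ℤ) (v : E) : evE z w (esmul c v) = c * evE z w v := by
  simp only [evE, esmul, ev_lsmul]; ring
theorem evE_neg (z w : S) (v : E) : evE z w (eneg v) = evE (-z) (-w) v := by
  simp only [evE, eneg, ev_lsmul, ev_lneg]; push_cast; ring
theorem evE_mul (q : List ℤ) (z w : S) (hw : w ^ 2 = ev z q) (u v : E) :
    evE z w (emul q u v) = evE z w u * evE z w v := by
  simp only [evE, emul, ev_ladd, ev_lmul, ← hw]; ring
theorem evE_isZ (z w : S) (v : E) (h : eisZ v = true) : evE z w v = 0 := by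
  simp only [eisZ, Bool.and_eq_true] at h
  simp [evE, ev_isZ z _ h.1, ev_isZ z _ h.2]
theorem map_evE {T : Type*} [CommRing T] (φ : S →+* T) (z w : S) (v : E) :
    φ (evE z w v) = evE (φ z) (φ w) v := by
  simp [evE, map_ev]

def evX (z w x : S) : List E → S
  | [] => 0
  | a :: l => evE z w a + x * evX z w x l

theorem evX_add (z w x : S) : ∀ a b : List E, evX z w x (xadd a b) = evX z w x a + evX z w x b
  | [], b => by simp [xadd, evX]
  | a :: l, [] => by simp [xadd, evX]
  | a :: l, b :: m => by simp only [xadd, evX, evX_add z w x l m, evE_add]; ring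
theorem evX_smul (q : List ℤ) (z w x : S) (hw : w ^ 2 = ev z q) (c : E) :
    ∀ a : List E, evX z w x (xsmul q c a) = evE z w c * evX z w x a
  | [] => by simp [xsmul, evX]
  | a :: l => by simp only [xsmul, evX, evX_smul q z w x hw c l, evE_mul q z w hw]; ring
theorem evX_mul (q : List ℤ) (z w x : S) (hw : w ^ 2 = ev z q) :
    ∀ a b : List E, evX z w x (xmul q a b) = evX z w x a * evX z w x b
  | [], b => by simp [xmul, evX]
  | a :: l, b => by
    simp only [xmul, evX, evX_add, evX_smul q z w x hw, evX_mul q z w x hw l b]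
    simp only [evE, ev]; ring
theorem evX_neg (z w x : S) : ∀ a : List E, evX z w x (xneg a) = evX (-z) (-w) x a
  | [] => by simp [xneg, evX]
  | a :: l => by simp only [xneg, evX, evE_neg, evX_neg z w x l]
theorem evX_isZ (z w x : S) : ∀ a : List E, xisZ a = true → evX z w x a = 0
  | [], _ => rfl
  | a :: l, h => by
    simp only [xisZ, Bool.and_eq_true] at h
    simp [evX, evE_isZ z w a h.1, evX_isZ z w x l h.2]
theorem evX_of (z w x : S) (e : E) : ∀ a : List ℤ, evX z w x (xof e a) = evE z w e * ev x a
  | [] => by simp [xof, evX, ev]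
  | a :: l => by simp only [xof, evX, evE_smul, evX_of z w x e l, ev]; ring
theorem map_evX {T : Type*} [CommRing T] (φ : S →+* T) (z w x : S) :
    ∀ a : List E, φ (evX z w x a) = evX (φ z) (φ w) (φ x) a
  | [] => by simp [evX]
  | a :: l => by simp [evX, map_evX φ z w x l, map_evE]
end
end Cert

namespace Cert
def dd : ℤ := 885505927861889752231188785446312141270174953214890751
def nn : ℤ := -10403056649859701823894175475278618126095087004501745582543939324526797950665
def ww : ℤ := 292253133999878874223782014112624680579914152350823400495618290428138660894470175509550995125268086170353783783100777149437576621182028369423127733992860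
def qL : List ℤ := [231301863284922936268485127085937931021951871642605133384087229765971310166792806278614125, 0, -1359465175067310726107809819264030458131286754, 0, 5]
def bd : List (ℕ × ℕ × ℤ) := [(0, 0, 1358291025),
  (1, 0, 17710118557237795044623775708926242825403499064297815020),
  (2, 0, 1568241496557092595570824465076842953468114149642975977446289347921001963927350047328968376298594881730688002),
  (3, 0, 69434357076015343108602012500763214152223405334240769562601320016333870846844688808127781568690242558643672993844095862364323253434473107565856298893881524823475100),
  (4, 0, 3074226739404536834109222032713567608764898306637541061121658628021111243063450235621145834622405669514920985154440677757739153746714646867603861996977225574268590662892317729319618416180117696266324430675600333440005),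
  (0, 1, 10691331150214242577734199576465568007429428792280720030567198000),
  (1, 1, 62729659862283703822832978603073718138724565985719039097851573916840078557094001893158735051943795269227520080),
  (2, 1, 11109497132162454897376322000122114264355744853478523130016211202613419335495150209300445050990438809382987679015055337978291720549515697210537007823021043971756016),
  (3, 1, 364107254431576779378188935951330868389633522888426673848801343267971810196983883357761248006501066554906541369924987492091876479828759094336666567512608814696494438816243476741180596446874842333135448082252096831945377837538761040268275531985887686147636400),
  (0, 2, 4733618555124593939239568050587337153400515718079024943235327201853776392466429602933917706744898106590511067092849000),
  (0, 3, 11736612414239612144834986615770157440565799943520969553810166051899983132861298358026406920984651418797353962738012615353309669108834075258203296899394434098973983350877200),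
  (0, 4, 31981354924538875547775676666213810021627236950172196236920400662425595917466013229654313916660179654841606846016766922442514495175102259310899385106496461150580796763487184982362485303974074609096009957573315697466953724270308598794155742864584084980009746394240911605370031331405303727353325)]
def JJ : List (List ℤ) := [[-27057542566488158357962670404138231053645970252943364791582141140652982896536884564079037416070764317918808472218083373636349520272512259197213746324120468453954006784873283514170393447943520054096613321391141820000958007382453229582547211329725774360472380837382581245032103187698548361510013739945873854744921363762035485165171824231647959685232620265180626401100303542687123047743627883283206899292465400681722645207602261806230734079078658454915433090020864089653475963782771293725824446629480240255, 366055087484142332711052778983803774135449775813319637867296326574942354024615024915117512873117610200342447023703715117305102712693149060712966523812708557159593049384184223444188955154812811934500969949372428856300140763823331193875510808530279102443966810974300599622534392945110036830345944118554950363555087855595048043312515170838387040620564605984024744607067203567423858449455635655597320880604179492808217719386605733096704535, -177981778591273729899593203098654634091859679862110177454812406021732075499909067973282400096211269920793320216459216327726449806601239359507615256691803777306018620054523796190203716967058939442461973196695822780945128678493163198310321579644463559119593067219657597140956041152631873337342079194186309916086561762790398073190722938267822648628686161595710625, -18831847811542951258613299925743390003356791656307020406027195134184969262160818331662353370965766318775809218385244991123299923366477498833852652189358281204498822258534952527933481267381306810661004914280704212686670052838706186843515109136949900151815415014519357962450521440905,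 -2862557858209298514558769187893191235316610442258044992451934311064943035655446793851656364927002541418583770238200871217687488648740167034976823624707395242878365671532969880621762085480658894369649976875, 31706336091313839614340573981994920744578491811283909297042848286047932006672783903590868321938463468682193010496455300358564371805361963984270496522727302429203596452922932075868610343273480691202122520421565485359013923676498963203228289475857971178533842760815082449371955957467664967241303906410950798295442842616267794273151203665523282876028576816693575710783905168435371882787394680004029511143823623173325084361629059, -1176179094706246168059405710730283583770885046601975958729217888349559816652860429093354582753201504204335231598473353344726847937428411345354878637594892360514571261162126025184853256870326630420110289052142757402980256208180795582258256675341014390893615616295363532712755475444142412126060169808950713433808720147763876127830224384592237886382585602402610, -110014665690347216696882119746350186244924490253648391308187693950670123252572841049801562262244912263457919842426672170439747520552226827303579660716477927997545468286383891558633803500495914934985462426746932807802113423950877934592807151585013924229450533778862570339182152063750, -4372398988137054683939324829568431543713201994787729421576955652740675287953902327120249117075326136275244175689473473461654015270619863798039553003033065105023815, 4229143718597599478706064482486262120268495604128836231867997335825704445356846590631256469801395779303767942562270627252421836670921278864885652584691529020684916807970822020868311311032112540433388614514015046374535093673577025826874421185747490012176389140142858459550256262535380792577288496770178534938364447403518910466998900910899410280774781,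 8588349781571672947296043361307770798800047762864724257583846546001958185009005947468941130036757573302125952723801236896308103626871790151920609390915969271601520205339934863702097248328153061911985492837839859772401295882458031854012082411632566351993127390245967958795, 6554168678723696140114755814656734849457819693946106667003525353112122070058096240203394534670082925319158166383079912048104395],
  [53414599293767100723399402185911132289280932373223118212708883933463169851521596148091961218559626155713412549255013208820931559206515163367829277081423065864435037674852029599287809551320558348765889211471319528206400506836781769365635826703790812224369680518018722078052273783081484992640117604449283334158470424164585360526918890697251366622093835468408292518333110847075059744583905280236546756877125328702110867935691336579270298096668339425645074296043543924714758422802074189662375381621154451070, -701475356094131204127222361746751860471121650012706228995475796397289508789001434740723434717332408779329235834175304432161995682395295843049545138411814711643828415447679040842559336283393272353977841912526657801807004194119872887418504882062312571424639598591432527055577794460049783917751533702721188230800667387084265925187202414709444959287136443731160022179244997588222784028402934897215914457135897658880455593490603711070803790, 314652581003217527446005604699734088853347823405799719988761420229493845813679876328743219729181215247570776719629469759415091424501467119494692700405774680383113840233636683442452943201296192334422929203374129784581213185706092205812328218847114902399563409799627652823663368994963097581289785183951843348243855739897648166574571714600964290137075123838597250, 46985703864465678807167889141628110319612891047557477624710831102962328898001081551051644819323792421223356028361337917976981554889769372489579792122830393867727564340749925416352859106434592302231131180790094479806584087747826736944004951474654163425989635418675786936355517481170,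 3114353079669188808402383984153735767639962864772420752066741399556566976420793800775592874646163510835085542827954442649013012179712417158749335676116545832091328463275614219847605045435452953175911329750, -95570338624419279394307770924747230433426512103876294674504835511783741335394097514036196969905081947973730122062285134238747793332993128580143131748241038693623085422626617168245833978232946502540003673356371451863725447046946780589614049419793309293671760287250554764362437198286411648903672856709706725276018684008671283975272459024657829488229602918002377844055490398753341602219546811587192661469924868150141196676704776, 2469043871806196907302420684791498895311531904854369758279389688754444030430384746778347382729231414901355142125625150019150332951939135422734602200088010735086299848255548815882177514231962185398185388334764145194856880536435197434671532590456277355126125107445026189188193012769182044638164596432842365100789612062032571869518525144147740389918393675777215, 179798147174133110774885250478259460611789325150209267798983300088378920018007654395792055736705661563238218100065035607371967700298340204721674419963597128630490123625514104259634406610064992966717950167570480028938729642145825575469677940419727898356099302765780000652331695177000, 9733200638631924052383624276646115792722863050854910597213765860897717161384018772106390057912829616757208011064193593831752183950343846958315498966242005874950635, -6599169305532072993356129108204152029299166964968057998368741339398494799615331205454726611419601444432625041504443085390756756303436801014998084831177422357806134554925588050552150984887369823910973665385081788247546623089686763640247912312397601925401582871438324482959870912114924275647433581565919694810054160790648952537850269799205282400104754,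 -7770850286609611366895409721923177613536840061767469007542998374287131669977149132069958438568760220458364991231030273402122948936626645638467652136117511860368444420512150464367656412782626787355447140239867387934977620658423078597100187558101673260394890995728218735805, -2063408999442840138170992099555777679872050197278257782881903050249534601472016410060278799221427622186421147761565142801823430],
  [-42043346051181433346116133227752065598619831195962743314248317506506653601091162143872186997783193951318573019291430189011262822878083017493946702570688487864544097929388137984080080760613640641242529205366400756852414357620983241316773943287826574865513765864719139861224239966067627857739994213857857156049690947564136275012897356518784536744987606873578965413362266446293247558688293448570121523676123806517292801007323910219647627423862093213535875399344757781919994683898314135247883266670883325285, 521485967387546644121010142150756818321347321136497039917601232172485482194756708416133954503986996275621277634532422981082662029483529294019602675621918742763139272023720165934955109262977731163847173723288530744282229190810948724721384612508729340719636973471241915570218003237011955367929291855159617666860807264559654245447338939207891048055503831580330331537993428004284818120730999903852210643197949829771702608797990328758144045, -210921594772349995917765669069432563466100691645914527229812709760558803933177083499225422895980216957885634869167165802808979786808264764227226070286043505003337184293288536605422578608158397890656101370460175954771249686697225546240594259040600461768563893500097997455241970765235390272067427456176639292768898857919375580852660415634797167770832994536300875, -42438924371879548022095854307783136294071728468089703775760260454530026147517025103875853248470555415745383180733096739353453540539845933285708722093747170444803499211964342387722680838265540455688110869135862847012974089030976255400471099128294536907487891358008090887763884225635,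 -1593156515553812709506117940433677223662792536913811664688031662045280881517597693454366223620144118696516014150501479710069371927515793685094034055639409749764935372536340852606040244780478900342145939625, 106405177875078929871948080988413567005446486320565593771740906838873763889099803043531110574546925828684849888448310566502981870107813434761925901192324319205913458047499544699051545832775473286623114049453444970764856412394832604534410749108988841656192639995648366476523228524876247871570966315595322599895561138532872328020513621483496643673222329489328023331963053713157172699980169144385030420838382972874413068590383288, -2011172480045293348541935404374789179745229625563683922754961313204570976418946821698775684287894611311333603186635181002160382077851954878284697189235715438792101910806981859253335242200323758612005317808731708820324948616605936546950852535404201068993306711672392619468261422519799244545069801454030378993246590613579931452025226724859562870608093936974695, -119357537821906652691667276498967487742370913737297156928588813072575146454375879154042779320430005749620401807854425017211833910910721461462869547433870331951339109470801040334033627626516205567374454086634823243305908494894254621754231718923691777699298484767587256736401511271125, -8646890479260819328181116403304457458389828777056768193722837054809021405022199742848040169326010476928597138420588330432653952936659310968179954267876566160870630, 3364942900885735508422029964023886247055864116904776973546619349505841323588764977401256270441477538838439972815926402522218427875999186180378218761083476154606233504485009622917639284977399878380540927748112677829845090846643387583330773707912977111485921973159339783555670744401211981058175931112499981575141747767558023051608633281418209176708987,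 225243134371751474349223236200045765762525447497568942190807499647050821595570971541925447354990689473300330876308506684996121906606992316044309282065644492268964331923551205759267326344391226241199056302900000380059769202008739116818119282566007736215109942714203811365, -2679441600295572467067326073006198323193061583314710809765905710143067123948977042727224720192833061842758166350811701654243335],
  [16464027331451669390297360377589995441409597936446373414280071998868589786461560116556814600404468082981329981536146285191661546277677514702558757957413448528996343324482398085513423228414407713633861529651886729295969827163812833912338892614702394440683927608474689622979431425671086896275187353126612190303091121212403319327150177753386586673202408039603661783241200382358021104742455100171235342870498338181372404157234080998518669526667033015818626190912855769638809330758225865259275201492235874460, -184866721633319401963680357921291903989161611247432285417397647944765945799665258821624850911330487494792521896304994587840003558376024469198426806774712520524808016931234489414430502562788396841193711229412829952207749341638324992955636325191469312593123057318219516600628353230415553540720543462635955934603859738456377575790749158553284833741472177539201107403785218295091991945676254979152690446337102814140569048993366557832461820, 64447713046189510362704907031569559724124708899095835903731426759398409087649897961309073590700860263280704051639015087981250659938343350984605743853536176167586598831147925215613689047867608552067343149239617621709038268383829169137567040938287396670928514305946154791439002505960643323860121440941786089016685252844962564011619004213129834032213794828188900, 17436442272931781354121671206153068287107475671167642980464935851613788063942132100323572797873103369502186565515678304475299667952964106214632931193903966853046281829857607623439384811123631573723628661979820115910623331559655438835753571179517423608577314247336163000685884974020,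 880762676493330822680320112055425022492208066606994111450593593536184428623148591818646945862375180241751223515822223585315992025084175387818184554849337442293825374474884208370683245885777743845012253900, -56342213805522045285799825200493515147099392524157003611190930401874535433920227075402984158853915813725432525245137558393634874387749987444854766453982346550518809274755068356502347377963345545353324328734288570781321435780117620723440049051159679191979227746439467041465865906931245978133425750300175733474523562078642240210777515850114092512251863737448945744635505374292225285670455791746132262976357020674704601625703888, 785435946719163404111251203920353470195419977487090473382001682208605983805325203835325032909210504765111736265901851862005125764842520250756686843880269707561818747266126798422989687841942250551488036510315326542296772737999130158826026158113081568145221416100056477963528485241926591806731758283461901829553224164622156704551187638536416205141682182543470, 42979581686134323010561690408293704175645834311056823263519701894944895018660762191991053717837794563935198423030006398588637251434314086456267580499015057247171432642469961314997730398831483507692079161119387431551652767070325241087775490297404707413846134422258387427634325672800, 3823221423050354684921277797202180019958067523720934256746650696453153192861048559539781626894284805043203118519598668589232391045145336075782156514001892529506070, -369032486566760210372578815904351095300580267682345292330957425802334687844045248614728056815653469261829045667219794035123731374484497382827781957644408861463398749540755021591775327621709968749982459379673979746945614020859054761521946059947604626712088627579679341956250039479619755348556597910710101913210952508896189801859815497835412360823652,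 1234645597850812750276386717908140172657476741798207525796030153732264677346108671281213515593082764392748588172162374910143751738415490163635874394501833566714499448033058765400448467356888260006757887732296333239236040820154560828700291950266803115487976350836226574310, 506648391425469368532628340298218452321515514008949320287412860202494327284887750852760268312119566913325750387064986104501460],
  [-3179544819627320156866614012906542437241334711290579147805961063997001540337347111770062662848660203704020335859780715849257865976035708677101474404882532651891595820914291086267606936572260814979513156416565931465119534726403840468464914143167430051937762941162342142192498471624606525534868908101936763695728696921563375847185075348381455004039573497178193306400406940795283630057350891442024611338737933446902251416830999659056528709408249316613299271841095024880638662493159865528871846018184686225, 30049108724785511799948364078610758034988830038657412871428376085219456057080265771077654794413128796814182375498236807170365191603959037882803960952832577584132515878197302136733632235726401605758390538450992877767813098013543963258505318933672371165373903467553486072435586365667700402902492530105953397107198429866708957536719543912853723435177881316384261615476503320763644061871488859262353762016834861696921073438478044921642425, -8018136302236602646195245172117569087826263430543490843451972672004286265243032946161122248498391332728606996276282811128139329785624668115728516061731175675096440685440528836289176589195999703106423089035307031645469677177640602583917160850597092916683623884378331947723594336670862717942405579470308619556763929007965657505363545723644488507753469956212975, -3191805048247715602252063560810655059677775781272469986590685440693561955809050990549119818390061937669189894789435966568174674496324419248902612805635750658630440237716918821206590457569981054015606984085333928253774722790470315609732542308479009468636932944057569206503275397127,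 -337971448574718081980970472332012403947092609611765811715358761888144540900210950604631484149652865423689639783327621769637503977846675511030065528203234348232123561622085603651416745681752990033488410725, 14353618690683593789938845293891690473572831220703540936859474346471849552019634027781549320674820403534480368358296300695110938096776720881295433524776774889517193960449855739154650020122885680235786876290684384790388751774973128504766859324942115504629202660205292418290441390012463924558370292313948859597830046335442795782673832367957032978212024352360552288580378707589341834565239904975460576894272622052558227334528795, -142839033894111782780749218154781344697378792415351223697132139471468356202483742898127982777582751258810020989684235952283563174742269111284002096283158756666779155826269378027968731660496316475206857537086026591169026915555755924226903427618671331176410361495380965775917493329262321114326691391298217775214624930864375147373414629962937908321861319434800, -9247174791180587934032232273925646759200650491112737897291643391468834621966631407351600547149275927575666402352964764806800486416871896187117405803507455092684183237548320526484529182712486813325758370720384595228914201126491488619209311920073242822827707580750246694567073457200, -835316798822094920908851663580724057128010313950069624542961430279203389236538500867066597485208509006292349954551248096069172012291806108448249905330787401333963, -178073593271479360705318335175505212910861076177598190311681995349189412324868214813574322514244854904723424554401124797982547438474507738935283594067670328779476821626151689385394467449540961644524142580666569921305650707698206626936058920067752900414783731771684684940560622655350465967929700873881399794362702813150069818036211852193839395375925,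 -128759658394267876554638375777888667283752704782402037276776892321302201291231043532480609874011845954117511380566765724499200268640670507531649385649654800468704221375530090506431987868775514424392327733993680677386768841981200016802907847671152529317495094570764829075, 448902328487118281314499661256618190983735731952407572058055141538831125814521429433244140727730030817091778685079125934437925],
  [228535892977898395826728711469737979694395377284281427504411510893219597449869167516828940929169633934057239738037582901973667431313471946169362257271896048387206506619879403370914192265401632440024986665789851810056447492347683032995787779697739898521290556199865300706101116368053747216522662736370503586681834004560918160752283459669061033783906132482068184903889659551037845527928797164862781036888258331198087582021020396500425117806640676060083007973082595315725093745326317045115428132774424966, -1523224167146390416146557498464403152688699534457200351863511792857038281471025479967820996658160055157275946568975719616584724148427172861715180921533643877533205754519048502733020643530205977702438596259228565309018686460212095835072595546053237149678689840264531796827207951391738170516707946547039633823283020882106752186683135094507949202780756513865285531205340229607029323059553770222950115841157648467633890471817811985977686, 137075538158000551565456424872578244872348339670321294775090078586575401081309123964827106796355488273153461561428331830191089692476769709527200347746747352054458772082562578854727976773444550152027396481738164683699521690257839023555121757499594004831902230247376718996390709337834385877622899518387670717608057353761027821965662028144383482145687386460538, 200494276627260779709596777343785715633944625228818919244818319811588703635530890360120005681019079425673329876416684246592030555841278832879983590824903395077048174311996631503759325004275788069706859930140376134608865828645201978478037239000463130657515692157328761871297004618,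 28189394658901975172719599875589064518541062903436079227457523201651793075283890668301246746469675509403285127197145079132784226384402629244354744383543067676196501292722652347005302412873148240742903678, -1390644263472643665267480627753931422292863543145149009443154969256544947362011688376825768924532350963548928807378752216083744368543568305899492404158414532762806589463119995279113026488033492113416014984134933100010947972586574226906324454622707537021440083065468611628505227100819051163908431732722907895041450380045316140569510781975077361363683848998789749519169367972725800508101669892100833282245673586166663093067440, 8468928617391129346776377093121209237328334362930078570062258548270014371709555248642259223020487602305202066150685346091868917452464012726355160747004865446052504129873913144040552292395546418550955062880216342327839453475756478864486000445437025049377135126625059821353953012473538115973920504998513212760732127188439401362200866641005545471075742599891, 1034195440448172525776802684710849428140238606748289046325826559417733555812927239108419177535560189324961817529060774293493416697000598702271690361765602657052832778577299113512400630479571922838581681060446494819125621723295270650276990990468427390646859234265500725844589909776, 69458545220765600095208364598416970686053580812315686921047449138469696687965076260518192910800991934896053779784096477437799567403686450761238823030546868542703, 42728706468022657633257704672855403725209226340790624240972139881995098694550232124472588009973946321093837741922444543222514056116420129631925885941313180316377430829384211808325853206329393813753142462932583890706173633657956475945004024359865079645499165594214459607875462539923466099906022663603762218937902328425949173975519430918381101780822,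 -73835392647330167393041273936164714721072679497050032787630507902021427190911931613028586018952182775458541872327191300344497928804949595110672412581072800157235339933898725855960477664811037336661531529501632624582707993692355767327005013848885326461532331046223696737, -37658778685548627156034169356634232021092081528958466526060710822538135328900923587881283560583680247293735807380285961360174],
  [3802013371827007590427938530142288632807526437230979250762726157221799550179733402565460334329019360164505163881909327408272092357315823507481104663408759652507603047443354273990715730338037326783782581626040578021071706673402295538706877131099907891281002002459440664061797224352676176133115597202756336626265214272690842592563524755461869674611254422973592726979137786883580534068701201802231788329652257931858562219381626355952469228513912757592013599618465915651993106592740297842712824967880021, -33139648027368484312586627630605735428593486742531638021444829860725768311429156576437952170614899329916043883483908504917653558006106175679623133294697481807836664881834597460195304276536365652636194094915661652579815438004013020171106039433064923227729776232794723710622825378764017234839724654258416182252488671143872580753660121744548252918469706216376745821528451786478971897703026230285212778247664277571832118512334344583901, 9988038799929261534431420591876491093074627549528067532932421824594718966680503673896036792583610852535309891019762727494803911511182582017634786927658782494353629478508932329153254645529445337262791327626604944768984632240958819428770975491646407069620634373316225848711195877316577733118085262078685349288239042476362163511815837343977304155360575372923, -3159625968664023946163601793043564014365606939715999837059868500557621595050256846178108668471201735067330745316481174160531324820252000663494870606877620519389773806637297143007438198336511008505938308352096215022894677076446818286270521704052368683205424635926554532311713645,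 7125282245630249891847922049866376298362256504893596731521712297913955816264397946620977876239488706752901202208448789933311782474497790275721577106173024347100079615280910406633928263978277455132009113, -9651538360494953800229710298360604875770764336739305123992131391450745245568772064754280843858145318397989657302534285833864683182940864930612787277961630924631116302527845520755864543460402369310275222642465468937460552496385086939039424667409450207225506201383218227594920449538536729506171275231048938898656059581678958066716941960138671547899335217063187512562522760217522948983804706984744399499451850885301472997838, 217592695447493628773025732087394658468788434827124586910740249683364815732184769153042548213622641879136435700018359849022288056356864703956757532508445733838502629996764077130478480341474814047321037868294307441079589679429405604706654046170876864449678399705181800401530662711718361876715124147083850379505904579253982958446919237311955853436421465481, -19190161855252619939692749404960207164629765106659775298544806408710190193052874352015474052916708381526246250707880132698046578325903006021941638648014020338572138726868507831758558065291817042692036688894876872386960001725342434022191534214934937557421754327440797099142130829, 783259976106320317580266046659245032292601700149525195448594005378633367084839291139664518597134364975129703666868931925232620836643333023193213905516512393416, -868207444887224804547803054530955420187630654152216688743961274273381315025430114397104963573789909598327922381012916404591259467038453294563575374743489999640895185260146261811258079439891567109361082384702791921274771994721321198225459340099156078205652635473361969993148831953597150877095426598768362838098297465037499417141606370334991941635,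 9634735861631092348409950663959064737163441903194004356133574147399400390172351432179462118863282738873069962947734038049216568933822189467559557885815122620611792540996723395998997389841717671841303149582266311864282466774912600650660233837552200414651285233882030683, -26599260760068533863943983783513146841264604923111676127827179358538534247419942330770535309551788519192845420670293682589769]]
def basis : List E := bd.map fun p =>
  esmul (p.2.2 * dd ^ (4 - p.2.1)) (emul qL (lmul (lpow [0, 1] p.1) (lpow [-nn, dd] (4 - p.2.1)), [])
    (epow qL ([ww], [dd ^ 2]) p.2.1))
def dotE : List ℤ → List E → E
  | [], _ => ([], [])
  | _ :: _, [] => ([], [])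
  | a :: l, e :: m => eadd (esmul a e) (dotE l m)
def ck : List E := JJ.map fun r => dotE r basis
def f1from : ℕ → List E → List E
  | _, [] => []
  | k, c :: l => xadd (xof c (lsmul (13809733116328248528705 ^ (6 - k))
      (lpow [43953684070277091550081, 217019] k))) (f1from (k + 1) l)
def f1 : List E := f1from 0 ck
def PL : List ℤ := lmul (lpow [4508281300847688731169319769769841835444, 87907368140554183100162, 217019] 5)
  [14635567009082568185596461891292367332677180975427256879233264,
   246529569778532375140876985021306849541294312, 37258218541488534910719399]
def QL : List ℤ := lmul (lpow [8443409213944751989643951279235627283533452107433272,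
    274156098050901691661379937349434622, 2223585235421468919] 3)
  [16436156522418265669179020769359057896808189915554213257292620245,
   225702085730490664288660568855789598873301353168, 0, 13385859493702]
def CL : List E := xmul qL f1 (xneg f1)
def AL : E := esmul (QL.getD 9 0) (CL.getD 12 ([], []))
def BL : E := eadd (esmul (PL.getD 12 0) (CL.getD 9 ([], [])))
  (esmul (- PL.getD 9 0) (CL.getD 12 ([], [])))
def KK : ℤ := PL.getD 12 0 * QL.getD 9 0
def resid : List E := xadd (xof (([-KK], [])) [1] |> fun k => xmul qL k CL) (xadd (xof AL PL) (xof BL QL))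
end Cert

namespace Cert
set_option linter.unusedSectionVars false
open Polynomial

def N2L : List ℤ := ladd (lmul AL.1 AL.1) (lsmul (-1) (lmul qL (lmul AL.2 AL.2)))
def N1L : List ℤ := lsmul 2 (ladd (lmul AL.1 BL.1) (lsmul (-1) (lmul qL (lmul AL.2 BL.2))))
def N0L : List ℤ := ladd (lmul BL.1 BL.1) (lsmul (-1) (lmul qL (lmul BL.2 BL.2)))
def DL : List ℤ := ladd (lmul AL.1 BL.2) (lsmul (-1) (lmul AL.2 BL.1))
def anyNZ : List ℤ → Bool
  | [] => false
  | a :: l => if a = 0 then anyNZ l else true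

def chk : Bool := xisZ resid && (isZ (N2L.drop 33) && (isZ (N1L.drop 32) && (isZ (N0L.drop 32) &&
  (decide (N2L.getD 32 0 ≠ 0) && (decide (N0L.getD 0 0 ≠ 0) && (anyNZ DL && (decide (KK ≠ 0) &&
  (eisZ (eadd (eneg AL) (esmul (-1) AL)) && (eisZ (eadd (eneg BL) (esmul (-1) BL)) &&
  (decide (PL.getD 12 0 ≠ 0) && (decide (f1.length = 7) && (isZ (PL.drop 13) && isZ (QL.drop 10)))))))))))))
theorem chk_eq : chk = true := by decide +kernel
theorem chk' : xisZ resid = true ∧ isZ (N2L.drop 33) = true ∧ isZ (N1L.drop 32) = true ∧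
  isZ (N0L.drop 32) = true ∧ N2L.getD 32 0 ≠ 0 ∧ N0L.getD 0 0 ≠ 0 ∧ anyNZ DL = true ∧ KK ≠ 0 ∧
  eisZ (eadd (eneg AL) (esmul (-1) AL)) = true ∧ eisZ (eadd (eneg BL) (esmul (-1) BL)) = true ∧
  PL.getD 12 0 ≠ 0 ∧ f1.length = 7 ∧ isZ (PL.drop 13) = true ∧ isZ (QL.drop 10) = true := by
  have := chk_eq
  simpa only [chk, Bool.and_eq_true, decide_eq_true_eq] using this

theorem key {S : Type*} [CommRing S] (z w x : S) (hw : w ^ 2 = ev z qL) :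
    (KK : S) * (evX z w x f1 * evX (-z) (-w) x f1)
      = evE z w AL * ev x PL + evE z w BL * ev x QL := by
  have h := evX_isZ z w x _ chk'.1
  rw [resid, evX_add, evX_add, evX_of, evX_of] at h
  simp only [evX_mul qL z w x hw, evX_of, CL, evX_neg] at h
  simp [evE, ev] at h
  simp only [evE]
  linear_combination -h

theorem getD_isZ : ∀ (k : ℕ) (l : List ℤ), isZ (l.drop k) = true → ∀ i, k ≤ i → l.getD i 0 = 0
  | 0, [], _, i, _ => by simp
  | 0, a :: l, h, i, _ => by
    simp only [List.drop_zero, isZ, Bool.and_eq_true, decide_eq_true_eq] at h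
    cases i with
    | zero => simpa using h.1
    | succ i => simpa using getD_isZ 0 l (by simpa using h.2) i (by omega)
  | k + 1, [], _, i, _ => by simp
  | k + 1, a :: l, h, i, hi => by
    cases i with
    | zero => omega
    | succ i => simpa using getD_isZ k l (by simpa using h) i (by omega)

theorem coeff_ev {S : Type*} [CommRing S] : ∀ (l : List ℤ) (i : ℕ),
    (ev (X : S[X]) l).coeff i = ((l.getD i 0 : ℤ) : S)
  | [], i => by simp [ev]
  | a :: l, 0 => by simp [ev]
  | a :: l, i + 1 => by
    have := coeff_ev (S := S) l i
    simp only [ev, coeff_add, coeff_X_mul, this, List.getD_cons_succ]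
    rw [show ((a : ℤ) : S[X]) = C (a : S) by simp, coeff_C]; simp

theorem anyNZ_ev : ∀ l : List ℤ, anyNZ l = true → (ev (X : ℤ[X]) l) ≠ 0 := by
  intro l
  induction l with
  | nil => simp [anyNZ]
  | cons a l ih =>
    intro h h0
    have hc : ∀ i, (ev (X : ℤ[X]) (a :: l)).coeff i = 0 := by intro i; rw [h0]; simp
    have ha : a = 0 := by simpa [coeff_ev] using hc 0
    simp only [anyNZ, ha, if_true] at h
    refine ih h ?_
    ext i
    have := hc (i + 1)
    rw [coeff_ev] at this ⊢
    simpa using this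

section
variable {M : Type*} [Field M] [CharZero M]

theorem ev_ne (Z : M) (hZ : Transcendental ℚ Z) (l : List ℤ) (hl : anyNZ l = true) : ev Z l ≠ 0 := by
  intro h
  have h1 : aeval Z (ev (X : ℚ[X]) l) = 0 := by
    have := map_ev (aeval Z : ℚ[X] →ₐ[ℚ] M).toRingHom X l
    simp only [AlgHom.toRingHom_eq_coe, RingHom.coe_coe, aeval_X] at this
    rw [this, h]
  have h2 : ev (X : ℚ[X]) l = 0 := (transcendental_iff.mp hZ) _ h1
  have h3 := map_ev (mapRingHom (Int.castRingHom ℚ)) X l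
  simp only [coe_mapRingHom, map_X] at h3
  rw [h2] at h3
  exact anyNZ_ev l hl ((Polynomial.map_eq_zero_iff Int.cast_injective).mp h3)

theorem alg_ev (Z : M) (hZ : IsAlgebraic ℚ Z) : ∀ l : List ℤ, IsAlgebraic ℚ (ev Z l)
  | [] => isAlgebraic_zero
  | a :: l => (isAlgebraic_intCast a).add (hZ.mul (alg_ev Z hZ l))

def Cond (T Z W : M) : Prop :=
  W ^ 2 = ev Z qL ∧ evE Z W AL ≠ 0 ∧ evE Z W AL * T + evE Z W BL = 0

theorem Cond.neg {T Z W : M} (h : Cond T Z W) : Cond T (-Z) (-W) := by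
  obtain ⟨h1, h2, h3⟩ := h
  have hA : evE (-Z) (-W) AL = evE Z W AL := by
    have := evE_isZ Z W _ chk'.2.2.2.2.2.2.2.2.1
    rw [evE_add, evE_neg, evE_smul] at this
    push_cast at this; linear_combination this
  have hB : evE (-Z) (-W) BL = evE Z W BL := by
    have := evE_isZ Z W _ chk'.2.2.2.2.2.2.2.2.2.1
    rw [evE_add, evE_neg, evE_smul] at this
    push_cast at this; linear_combination this
  refine ⟨?_, by rwa [hA], by rwa [hA, hB]⟩
  rw [neg_sq, h1]
  simp only [qL, ev]; push_cast; ring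

theorem Cond.map {T Z W : M} (h : Cond T Z W) (σ : M ≃+* M) (hσ : σ T = T) :
    Cond T (σ Z) (σ W) := by
  obtain ⟨h1, h2, h3⟩ := h
  have e1 : ∀ u, evE (σ Z) (σ W) u = σ (evE Z W u) := fun u =>
    (map_evE σ.toRingHom Z W u).symm
  refine ⟨?_, ?_, ?_⟩
  · have := map_ev σ.toRingHom Z qL
    simp only [RingEquiv.toRingHom_eq_coe, RingEquiv.coe_toRingHom] at this
    rw [← this, ← h1, map_pow]
  · rw [e1]; simpa using h2
  · rw [e1, e1]
    have := congrArg σ h3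
    simpa [hσ] using this

theorem Cond.trans {T Z W : M} (hT : Transcendental ℚ T) (h : Cond T Z W) : Transcendental ℚ Z := by
  intro hZ
  obtain ⟨h1, h2, h3⟩ := h
  have hW : IsAlgebraic ℚ W := by
    refine IsAlgebraic.of_pow (n := 2) (by norm_num) ?_
    rw [h1]; exact alg_ev Z hZ _
  have hE : ∀ u, IsAlgebraic ℚ (evE Z W u) := fun u =>
    (alg_ev Z hZ _).add (hW.mul (alg_ev Z hZ _))
  apply hT
  have : T = - evE Z W BL * (evE Z W AL)⁻¹ := by
    field_simp; linear_combination h3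
  rw [this]
  exact (hE _).neg.mul (hE _).inv

theorem D_ne {Z : M} (hZ : Transcendental ℚ Z) :
    ev Z AL.1 * ev Z BL.2 - ev Z AL.2 * ev Z BL.1 ≠ 0 := by
  have := ev_ne Z hZ DL chk'.2.2.2.2.2.2.1
  rw [DL, ev_ladd, ev_lsmul, ev_lmul, ev_lmul] at this
  intro h; apply this; push_cast; linear_combination h

noncomputable def Wof (T Z : M) : M :=
  -(ev Z AL.1 * T + ev Z BL.1) / (ev Z AL.2 * T + ev Z BL.2)

noncomputable def NN (T : M) : M[X] :=
  C (T ^ 2) * ev X N2L + C T * ev X N1L + ev X N0L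

theorem eval_ev (Z : M) (l : List ℤ) : (ev (X : M[X]) l).eval Z = ev Z l := by
  have := map_ev (evalRingHom Z) X l
  simpa using this

theorem eval_NN (T Z : M) : (NN T).eval Z = (ev Z AL.1 * T + ev Z BL.1) ^ 2
    - ev Z qL * (ev Z AL.2 * T + ev Z BL.2) ^ 2 := by
  simp only [NN, eval_add, eval_mul, eval_C, eval_ev]
  simp only [N2L, N1L, N0L, ev_ladd, ev_lsmul, ev_lmul]
  push_cast; ring

theorem Cond.sum {T Z W : M} (h : Cond T Z W) :
    (ev Z AL.1 * T + ev Z BL.1) + W * (ev Z AL.2 * T + ev Z BL.2) = 0 := by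
  have := h.2.2
  simp only [evE] at this
  linear_combination this

theorem Cond.W_eq {T Z W : M} (hT : Transcendental ℚ T) (h : Cond T Z W) : W = Wof T Z := by
  have hs := h.sum
  have hd : ev Z AL.2 * T + ev Z BL.2 ≠ 0 := by
    intro hd
    rw [hd] at hs
    apply D_ne (h.trans hT)
    linear_combination ev Z AL.1 * hd - ev Z AL.2 * hs
  rw [Wof, eq_div_iff hd]; linear_combination hs

theorem Cond.root {T Z W : M} (h : Cond T Z W) : (NN T).eval Z = 0 := by
  rw [eval_NN, ← h.1]
  have hs := h.sum
  linear_combination (ev Z AL.1 * T + ev Z BL.1 - W * (ev Z AL.2 * T + ev Z BL.2)) * hs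

theorem NN_coeff (T : M) (i : ℕ) : (NN T).coeff i =
    T ^ 2 * ((N2L.getD i 0 : ℤ) : M) + T * ((N1L.getD i 0 : ℤ) : M) + ((N0L.getD i 0 : ℤ) : M) := by
  rw [NN, coeff_add, coeff_add, coeff_C_mul, coeff_C_mul, coeff_ev, coeff_ev, coeff_ev]

theorem NN_deg (T : M) : (NN T).natDegree ≤ 32 := by
  rw [natDegree_le_iff_coeff_eq_zero]
  intro i hi
  rw [NN_coeff, getD_isZ _ _ chk'.2.1 i (by omega), getD_isZ _ _ chk'.2.2.1 i (by omega),
    getD_isZ _ _ chk'.2.2.2.1 i (by omega)]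
  simp

theorem NN_c32 (T : M) : (NN T).coeff 32 = T ^ 2 * ((N2L.getD 32 0 : ℤ) : M) := by
  rw [NN_coeff, getD_isZ _ _ chk'.2.2.1 32 le_rfl, getD_isZ _ _ chk'.2.2.2.1 32 le_rfl]
  simp

theorem T_ne {T : M} (hT : Transcendental ℚ T) : T ≠ 0 := by
  rintro rfl; exact hT isAlgebraic_zero

theorem NN_c32_ne {T : M} (hT : Transcendental ℚ T) : (NN T).coeff 32 ≠ 0 := by
  rw [NN_c32]
  exact mul_ne_zero (pow_ne_zero _ (T_ne hT)) (Int.cast_ne_zero.mpr chk'.2.2.2.2.1)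

theorem NN_ne {T : M} (hT : Transcendental ℚ T) : NN T ≠ 0 := by
  intro h; apply NN_c32_ne hT; rw [h]; simp

theorem NN_nd {T : M} (hT : Transcendental ℚ T) : (NN T).natDegree = 32 :=
  le_antisymm (NN_deg T) (le_natDegree_of_ne_zero (NN_c32_ne hT))

theorem exists_cond [IsAlgClosed M] {T : M} (hT : Transcendental ℚ T) : ∃ Z W, Cond T Z W := by
  have hex : ∃ Z ∈ (NN T).roots, Transcendental ℚ Z := by
    by_contra! hcon
    have halg : ∀ Z ∈ (NN T).roots, IsAlgebraic ℚ Z := fun Z hZ => by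
      have := hcon Z hZ
      simpa [Transcendental] using this
    have hprod : IsAlgebraic ℚ (NN T).roots.prod := by
      revert halg
      generalize (NN T).roots = s
      intro hs
      induction s using Multiset.induction_on with
      | empty => simpa using isAlgebraic_one
      | cons a s ih =>
        rw [Multiset.prod_cons]
        exact (hs a (by simp)).mul (ih fun z hz => hs z (by simp [hz]))
    have hc := (IsAlgClosed.splits (NN T)).coeff_zero_eq_leadingCoeff_mul_prod_roots
    rw [leadingCoeff, NN_nd hT, NN_c32, NN_coeff] at hc
    set r := (NN T).roots.prod with hr
    let L := algebraicClosure ℚ M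
    have hrL : r ∈ L := by rw [mem_algebraicClosure_iff]; exact hprod
    let r' : L := ⟨r, hrL⟩
    have hTL : IsAlgebraic L T := by
      refine ⟨C ((N2L.getD 0 0 : ℤ) - (-1) ^ 32 * (N2L.getD 32 0 : ℤ) * r' : L) * X ^ 2 + C ((N1L.getD 0 0 : ℤ) : L) * X
        + C ((N0L.getD 0 0 : ℤ) : L), ?_, ?_⟩
      · intro h0
        have := congrArg (fun p => p.coeff 0) h0
        simp only [coeff_add, coeff_C_mul, coeff_X_pow, coeff_X_zero, coeff_C_zero, coeff_zero] at this
        have h3 : ((N0L.getD 0 0 : ℤ) : L) = 0 := by simpa using this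
        exact chk'.2.2.2.2.2.1 (by exact_mod_cast h3)
      · simp only [map_add, map_mul, aeval_C, map_pow, aeval_X, map_sub, map_intCast, map_neg, map_one]
        rw [show algebraMap L M r' = r from rfl]
        linear_combination hc
    apply hT
    have : Algebra.IsAlgebraic ℚ L := algebraicClosure.isAlgebraic ℚ M
    exact hTL.restrictScalars ℚ
  obtain ⟨Z, hZr, hZ⟩ := hex
  have h0 : (NN T).eval Z = 0 := (mem_roots'.mp hZr).2
  rw [eval_NN] at h0
  have hd : ev Z AL.2 * T + ev Z BL.2 ≠ 0 := by
    intro hd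
    rw [hd] at h0
    have h1 : ev Z AL.1 * T + ev Z BL.1 = 0 := by
      apply pow_eq_zero_iff (n := 2) (by norm_num) |>.mp; linear_combination h0
    apply D_ne hZ
    linear_combination ev Z AL.1 * hd - ev Z AL.2 * h1
  have hW : Wof T Z * (ev Z AL.2 * T + ev Z BL.2) = -(ev Z AL.1 * T + ev Z BL.1) := by
    rw [Wof, div_mul_cancel₀ _ hd]
  have h3 : evE Z (Wof T Z) AL * T + evE Z (Wof T Z) BL = 0 := by
    simp only [evE]; linear_combination hW
  refine ⟨Z, Wof T Z, ?_, ?_, h3⟩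
  · rw [Wof, div_pow, div_eq_iff (pow_ne_zero _ hd)]; linear_combination h0
  · intro hA
    rw [hA] at h3
    apply D_ne hZ
    simp only [evE] at h3 hA
    linear_combination ev Z BL.2 * hA - ev Z AL.2 * h3

end
end Cert

namespace Cert
open Polynomial

section
variable {M : Type*} [Field M] [CharZero M]

noncomputable def fp (Z W : M) : M[X] := evX (C Z) (C W) X f1
noncomputable def hp (T : M) : M[X] := ev X PL - C T * ev X QL

theorem evX_deg (Z W : M) : ∀ l : List E, (evX (C Z) (C W) X l : M[X]).degree < l.length
  | [] => by simp [evX]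
  | a :: l => by
    have ih := evX_deg Z W l
    have h1 : (evE (C Z) (C W) a : M[X]) = C (evE Z W a) := (map_evE C Z W a).symm
    simp only [evX, h1]
    rw [degree_lt_iff_coeff_zero] at ih ⊢
    intro m hm
    simp only [List.length_cons] at hm
    cases m with
    | zero => omega
    | succ m =>
      rw [coeff_add, coeff_X_mul, ih m (by omega), coeff_C]; simp

theorem fp_deg (Z W : M) : (fp Z W).natDegree ≤ 6 := by
  have := evX_deg Z W f1
  rw [chk'.2.2.2.2.2.2.2.2.2.2.2.1] at this
  rw [natDegree_le_iff_coeff_eq_zero]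
  intro m hm
  exact (degree_lt_iff_coeff_zero _ 7).mp this m (by omega)

theorem fp_eval (Z W x : M) : (fp Z W).eval x = evX Z W x f1 := by
  have := map_evX (evalRingHom x) (C Z) (C W) X f1
  simpa [fp] using this

theorem hp_ne (T : M) : hp T ≠ 0 := by
  intro h
  have := congrArg (fun p => p.coeff 12) h
  simp only [hp, coeff_sub, coeff_C_mul, coeff_ev, coeff_zero] at this
  rw [getD_isZ _ QL chk'.2.2.2.2.2.2.2.2.2.2.2.2.2 12 (by norm_num)] at this
  have h2 := chk'.2.2.2.2.2.2.2.2.2.2.1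
  simp only [Int.cast_zero, mul_zero, sub_zero, Int.cast_eq_zero] at this
  exact h2 this

theorem Cond.prod {T Z W : M} (h : Cond T Z W) :
    C (KK : M) * (fp Z W * fp (-Z) (-W)) = C (evE Z W AL) * hp T := by
  have := key (C Z : M[X]) (C W) X (by rw [← map_pow, h.1, map_ev])
  rw [← map_evE, ← map_evE] at this
  have hB : evE Z W BL = - (evE Z W AL * T) := by linear_combination h.2.2
  rw [hB] at this
  simp only [fp, hp, map_neg, map_mul] at this ⊢
  simp only [map_intCast] at this ⊢
  linear_combination this

theorem Cond.fp_ne {T Z W : M} (h : Cond T Z W) : fp Z W ≠ 0 := by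
  intro h0
  have := h.prod
  rw [h0, zero_mul, mul_zero] at this
  exact mul_ne_zero (C_ne_zero.mpr h.2.1) (hp_ne T) this.symm

variable (r : Fin 12 → M)

open Classical in
noncomputable def ind (Z W : M) : Fin 12 → Bool := fun i => decide ((fp Z W).eval (r i) = 0)

theorem ind_count {T Z W : M} (hr : Function.Injective r) (h : Cond T Z W) :
    (Finset.univ.filter (fun i => ind r Z W i = true)).card ≤ 6 := by
  classical
  have : (Finset.univ.filter (fun i => ind r Z W i = true)).card
      = ((Finset.univ.filter (fun i => ind r Z W i = true)).image r).card :=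
    (Finset.card_image_of_injective _ hr).symm
  rw [this]
  refine (Finset.card_le_card (t := (fp Z W).roots.toFinset) ?_).trans
    ((Multiset.toFinset_card_le _).trans ((card_roots' _).trans (fp_deg Z W)))
  intro x hx
  simp only [Finset.mem_image, Finset.mem_filter, Finset.mem_univ, true_and, ind,
    decide_eq_true_eq] at hx
  obtain ⟨i, hi, rfl⟩ := hx
  simp [h.fp_ne, hi]

theorem ind_or {T Z W : M} (hr : ∀ i, (hp T).eval (r i) = 0) (h : Cond T Z W) (i : Fin 12) :
    ind r Z W i = true ∨ ind r (-Z) (-W) i = true := by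
  have := congrArg (eval (r i)) h.prod
  rw [eval_mul, eval_mul, eval_mul, hr i, eval_C, mul_zero] at this
  have hK : (KK : M) ≠ 0 := Int.cast_ne_zero.mpr chk'.2.2.2.2.2.2.2.1
  simpa [ind, hK] using this

theorem ind_split {T Z W : M} (hi : Function.Injective r) (hr : ∀ i, (hp T).eval (r i) = 0)
    (h : Cond T Z W) :
    (Finset.univ.filter (fun i => ind r Z W i = true)).card = 6 ∧
    (fun i => !(ind r Z W i)) = ind r (-Z) (-W) := by
  classical
  have c1 := ind_count r hi h
  have c2 := ind_count r hi h.neg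
  set S := Finset.univ.filter (fun i => ind r Z W i = true) with hS
  set S' := Finset.univ.filter (fun i => ind r (-Z) (-W) i = true) with hS'
  have hU : S ∪ S' = Finset.univ := by
    ext i
    have := ind_or r hr h i
    simpa [hS, hS'] using this
  have hc := Finset.card_union_add_card_inter S S'
  rw [hU] at hc
  simp only [Finset.card_univ, Fintype.card_fin] at hc
  have hI : S ∩ S' = ∅ := Finset.card_eq_zero.mp (by omega)
  refine ⟨by omega, ?_⟩
  funext i
  have h1 := ind_or r hr h i
  have h2 : ¬ (ind r Z W i = true ∧ ind r (-Z) (-W) i = true) := by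
    intro hh
    have : i ∈ S ∩ S' := by simp [hS, hS', hh.1, hh.2]
    rw [hI] at this; simp at this
  cases h3 : ind r Z W i <;> cases h4 : ind r (-Z) (-W) i <;> simp_all

open Classical in
noncomputable def BB (T : M) : Finset (Fin 12 → Bool) :=
  ((NN T).roots.toFinset.filter (fun Z => Cond T Z (Wof T Z))).image (fun Z => ind r Z (Wof T Z))

theorem mem_BB {T : M} (hT : Transcendental ℚ T) (f : Fin 12 → Bool) :
    f ∈ BB r T ↔ ∃ Z W, Cond T Z W ∧ f = ind r Z W := by
  classical
  simp only [BB, Finset.mem_image, Finset.mem_filter]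
  constructor
  · rintro ⟨Z, ⟨-, h⟩, rfl⟩; exact ⟨Z, _, h, rfl⟩
  · rintro ⟨Z, W, h, rfl⟩
    have hW := h.W_eq hT
    subst hW
    exact ⟨Z, ⟨by simp [NN_ne hT, h.root], h⟩, rfl⟩

theorem BB_card {T : M} : (BB r T).card ≤ 43 := by
  classical
  refine Finset.card_image_le.trans ((Finset.card_filter_le _ _).trans ?_)
  exact ((Multiset.toFinset_card_le _).trans ((card_roots' _).trans (NN_deg T))).trans (by norm_num)

theorem main_group [IsAlgClosed M] {T : M} (hT : Transcendental ℚ T)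
    (hi : Function.Injective r) (hr : ∀ i, (hp T).eval (r i) = 0)
    (H : Subgroup (Equiv.Perm (Fin 12))) (h2 : M11G.TwoTr H)
    (hH : ∀ g ∈ H, ∃ σ : M ≃+* M, σ T = T ∧ ∀ i, σ (r i) = r (g i)) :
    IsSimpleGroup H ∧ Nat.card H = 7920 := by
  refine M11G.final (B := BB r T) ⟨h2, ?_, BB_card r, ?_, ?_, ?_⟩
  · obtain ⟨Z, W, h⟩ := exists_cond hT
    exact ⟨_, (mem_BB r hT _).mpr ⟨Z, W, h, rfl⟩⟩
  · intro f hf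
    obtain ⟨Z, W, h, rfl⟩ := (mem_BB r hT _).mp hf
    exact (ind_split r hi hr h).1
  · intro f hf
    obtain ⟨Z, W, h, rfl⟩ := (mem_BB r hT _).mp hf
    exact (mem_BB r hT _).mpr ⟨-Z, -W, h.neg, (ind_split r hi hr h).2⟩
  · intro g hg f hf
    obtain ⟨Z, W, h, rfl⟩ := (mem_BB r hT _).mp hf
    obtain ⟨σ, hσ, hσr⟩ := hH g hg
    have hs : σ.symm T = T := by rw [RingEquiv.symm_apply_eq, hσ]
    refine (mem_BB r hT _).mpr ⟨σ.symm Z, σ.symm W, h.map σ.symm hs, ?_⟩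
    funext i
    simp only [ind]
    rw [decide_eq_decide, ← hσr, fp_eval, fp_eval]
    have := map_evX σ.toRingHom (σ.symm Z) (σ.symm W) (r i) f1
    simp only [RingEquiv.toRingHom_eq_coe, RingEquiv.coe_toRingHom, RingEquiv.apply_symm_apply] at this
    rw [← this]; simp
end
end Cert

namespace Cert
open Polynomial

def m17 : List ℤ → List ℤ
  | [] => []
  | a :: l => (a % 17) :: m17 l
def low17 : List ℤ := [6, 15, 7, 10, 11, 8, 5, 3, 3, 12, 12]
def mulX17 (r : List ℤ) : List ℤ :=
  if r.length = 11 then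
    m17 (ladd (0 :: r.dropLast) (lsmul (-(r.getD 10 0)) low17))
  else 0 :: r
def red17 : List ℤ → List ℤ
  | [] => []
  | a :: l => m17 (ladd [a] (mulX17 (red17 l)))
def sq17 (a : List ℤ) : List ℤ := red17 (lmul a a)
def pow17 (a : List ℤ) : List ℤ := red17 (lmul a (sq17 (sq17 (sq17 (sq17 a)))))
def it17 : ℕ → List ℤ
  | 0 => [0, 1]
  | n + 1 => pow17 (it17 n)
theorem chk17 : isZ (m17 (ladd (it17 11) [0, -1])) = true := by decide +kernel

section
variable {S : Type*} [CommRing S]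
theorem ev_m17 (h17 : (17 : S) = 0) (z : S) : ∀ l : List ℤ, ev z (m17 l) = ev z l
  | [] => rfl
  | a :: l => by
    have h1 : ((a % 17 : ℤ) : S) = a := by
      conv_rhs => rw [← Int.emod_add_mul_ediv a 17]
      push_cast
      rw [h17]; ring
    simp only [m17, ev, ev_m17 h17 z l, h1]
theorem ev_append (z : S) : ∀ l m : List ℤ, ev z (l ++ m) = ev z l + z ^ l.length * ev z m
  | [], m => by simp [ev]
  | a :: l, m => by
    simp only [List.cons_append, ev, ev_append z l m, List.length_cons]; ring
theorem ev_mulX17 (h17 : (17 : S) = 0) (z : S) (hz : ev z low17 + z ^ 11 = 0) (r : List ℤ) : ev z (mulX17 r) = z * ev z r := by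
  unfold mulX17
  split_ifs with h
  · rw [ev_m17 h17, ev_ladd, ev_lsmul]
    have hr : r = r.dropLast ++ [r.getD 10 0] := by
      have hne : r ≠ [] := by rintro rfl; simp at h
      conv_lhs => rw [← List.dropLast_append_getLast hne]
      congr 2
      rw [List.getLast_eq_getElem]
      simp [h]
    conv_rhs => rw [hr, ev_append]
    have hl : r.dropLast.length = 10 := by simp [h]
    rw [hl]
    simp only [ev]
    push_cast
    linear_combination (-(r.getD 10 0 : ℤ) : S) * hz
  · simp [ev]
theorem ev_red17 (h17 : (17 : S) = 0) (z : S) (hz : ev z low17 + z ^ 11 = 0) : ∀ l : List ℤ, ev z (red17 l) = ev z l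
  | [] => rfl
  | a :: l => by
    simp only [red17, ev_m17 h17, ev_ladd, ev_mulX17 h17 z hz, ev_red17 h17 z hz l, ev]; ring
theorem ev_pow17 (h17 : (17 : S) = 0) (z : S) (hz : ev z low17 + z ^ 11 = 0) (a : List ℤ) : ev z (pow17 a) = ev z a ^ 17 := by
  simp only [pow17, sq17, ev_red17 h17 z hz, ev_lmul]; ring
theorem ev_it17 (h17 : (17 : S) = 0) (z : S) (hz : ev z low17 + z ^ 11 = 0) : ∀ n : ℕ, ev z (it17 n) = z ^ 17 ^ n
  | 0 => by simp [it17, ev]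
  | n + 1 => by rw [it17, ev_pow17 h17 z hz, ev_it17 h17 z hz n, ← pow_mul, pow_succ]
theorem pow_1711 (h17 : (17 : S) = 0) (z : S) (hz : ev z low17 + z ^ 11 = 0) : z ^ 17 ^ 11 = z := by
  have := ev_isZ z _ chk17
  rw [ev_m17 h17, ev_ladd, ev_it17 h17 z hz] at this
  simp [ev] at this
  linear_combination this
end

noncomputable def f17 : (ZMod 17)[X] := ev X low17 + X ^ 11
instance : Fact (Nat.Prime 17) := ⟨by norm_num⟩

theorem f17_deg : f17.natDegree = 11 := by
  have : f17 = X ^ 11 + ev X low17 := add_comm _ _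
  rw [this]
  simp only [low17, ev]
  norm_num
  compute_degree!

theorem f17_noroot (a : ZMod 17) : f17.eval a ≠ 0 := by
  have h1 : f17.eval a = ev a low17 + a ^ 11 := by
    have := map_ev (evalRingHom a) X low17
    simp only [coe_evalRingHom, eval_X] at this
    rw [f17, eval_add, this]; simp
  rw [h1]
  clear h1
  simp only [low17, ev]
  revert a
  decide +kernel

theorem f17_dvd : f17 ∣ X ^ 17 ^ 11 - X := by
  rw [← AdjoinRoot.mk_eq_zero, map_sub, map_pow, AdjoinRoot.mk_X, sub_eq_zero]
  apply pow_1711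
  · have : (17 : ZMod 17) = 0 := by decide
    rw [← map_ofNat (AdjoinRoot.of f17) 17]
    exact (congrArg (AdjoinRoot.of f17) this).trans (map_zero _)
  · have := map_ev (AdjoinRoot.mk f17) X low17
    rw [AdjoinRoot.mk_X] at this
    rw [← this, ← AdjoinRoot.mk_X, ← map_pow, ← map_add]
    exact AdjoinRoot.mk_self

theorem f17_irr' (n : ℕ) (hdvd : f17 ∣ X ^ 17 ^ n - X) (hn : n = 11) : Irreducible f17 := by
  have h0 : f17 ≠ 0 := by intro h; have := f17_deg; rw [h] at this; simp at this
  have hnu : ¬ IsUnit f17 := by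
    intro hu
    have := natDegree_eq_zero_of_isUnit hu
    rw [f17_deg] at this; norm_num at this
  obtain ⟨g, hg, hgf⟩ := WfDvdMonoid.exists_irreducible_factor hnu h0
  have hd : g.natDegree ∣ n := by
    apply hg.natDegree_dvd_of_dvd_X_pow_card_pow_sub_X
    rw [Nat.card_zmod]
    exact hgf.trans hdvd
  rw [hn] at hd
  rcases (Nat.dvd_prime (by norm_num)).mp hd with h1 | h11
  · obtain ⟨a, ha⟩ := exists_root_of_degree_eq_one (degree_eq_iff_natDegree_eq_of_pos (by norm_num) |>.mpr h1)
    exact absurd (eval_eq_zero_of_dvd_of_eval_eq_zero hgf ha) (f17_noroot a)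
  · obtain ⟨k, hk⟩ := hgf
    have hk0 : k ≠ 0 := by rintro rfl; rw [mul_zero] at hk; exact h0 hk
    have := natDegree_mul hg.ne_zero hk0
    rw [← hk, f17_deg, h11] at this
    have hk1 : k.natDegree = 0 := by omega
    have hku : IsUnit k := by
      rw [eq_C_of_natDegree_eq_zero hk1] at hk0 ⊢
      exact isUnit_C.mpr (isUnit_iff_ne_zero.mpr (by simpa using hk0))
    rw [hk]
    exact (irreducible_mul_isUnit hku).mpr hg

theorem f17_irr : Irreducible f17 := f17_irr' 11 f17_dvd rfl
end Cert

namespace Cert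
open Polynomial

theorem irr_of_map {R k : Type*} [CommRing R] [IsDomain R] [UniqueFactorizationMonoid R]
    [Field k] (φ : R →+* k) (f : R[X]) (hl : φ f.leadingCoeff ≠ 0) (hirr : Irreducible (f.map φ)) :
    Irreducible (f.map (algebraMap R (FractionRing R))) := by
  classical
  let _ : NormalizedGCDMonoid R := Nonempty.some inferInstance
  have hf := f.eq_C_content_mul_primPart
  set c := f.content with hc
  set p := f.primPart with hp
  have hlc : f.leadingCoeff = c * p.leadingCoeff := by
    conv_lhs => rw [hf]
    rw [leadingCoeff_mul, leadingCoeff_C]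
  have hc0 : φ c ≠ 0 := by intro h; apply hl; rw [hlc, map_mul, h, zero_mul]
  have hp0 : φ p.leadingCoeff ≠ 0 := by intro h; apply hl; rw [hlc, map_mul, h, mul_zero]
  have hprim : p.IsPrimitive := f.isPrimitive_primPart
  have hpi : Irreducible (p.map φ) := by
    have : f.map φ = C (φ c) * p.map φ := by conv_lhs => rw [hf]; rw [Polynomial.map_mul, map_C]
    rw [this] at hirr
    exact (irreducible_isUnit_mul (isUnit_C.mpr (isUnit_iff_ne_zero.mpr hc0))).mp hirr
  have hp1 : Irreducible p := by
    refine ⟨fun hu => hpi.not_isUnit (hu.map (mapRingHom φ)), ?_⟩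
    have main : ∀ a b : R[X], p = a * b → IsUnit (a.map φ) → IsUnit a := by
      intro a b hab ha
      have hla : φ a.leadingCoeff ≠ 0 := by
        intro h; apply hp0; rw [hab, leadingCoeff_mul, map_mul, h, zero_mul]
      have hd : a.natDegree = 0 := by
        rw [← natDegree_map_of_leadingCoeff_ne_zero φ hla]
        exact natDegree_eq_zero_of_isUnit ha
      rw [eq_C_of_natDegree_eq_zero hd] at hab ⊢
      exact isUnit_C.mpr (hprim _ ⟨b, hab⟩)
    intro a b hab
    have h2 : p.map φ = a.map φ * b.map φ := by rw [hab, Polynomial.map_mul]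
    rcases hpi.isUnit_or_isUnit h2 with h | h
    · exact Or.inl (main a b hab h)
    · exact Or.inr (main b a (by rw [hab, mul_comm]) h)
  have hpK := (hprim.irreducible_iff_irreducible_map_fraction_map (K := FractionRing R)).mp hp1
  have : f.map (algebraMap R (FractionRing R)) = C (algebraMap R (FractionRing R) c) *
      p.map (algebraMap R (FractionRing R)) := by
    conv_lhs => rw [hf]; rw [Polynomial.map_mul, map_C]
  rw [this]
  refine (irreducible_isUnit_mul (isUnit_C.mpr (isUnit_iff_ne_zero.mpr ?_))).mpr hpK
  intro h
  apply hc0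
  rw [(FaithfulSMul.algebraMap_injective R (FractionRing R)) (h.trans (map_zero _).symm), map_zero]

noncomputable def GG : (ℤ[X])[X] :=
  ev (X : (ℤ[X])[X]) PL * C (ev (X : ℤ[X]) QL) - ev (X : (ℤ[X])[X]) QL * C (ev (X : ℤ[X]) PL)
noncomputable def ht : (ℤ[X])[X] := GG /ₘ (X - C X)

theorem eval_ev' {S : Type*} [CommRing S] (Z : S) (l : List ℤ) :
    (ev (X : S[X]) l).eval Z = ev Z l := by
  have := map_ev (evalRingHom Z) X l
  simpa using this

theorem map_ev' {S T : Type*} [CommRing S] [CommRing T] (φ : S →+* T) (l : List ℤ) :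
    (ev (X : S[X]) l).map φ = ev X l := by
  have := map_ev (mapRingHom φ) X l
  simpa using this

theorem ht_mul : (X - C X) * ht = GG := by
  rw [ht, mul_divByMonic_eq_iff_isRoot, IsRoot, GG]
  simp only [eval_sub, eval_mul, eval_C, eval_ev']; ring

noncomputable def phi : ℤ[X] →+* ZMod 17 := eval₂RingHom (Int.castRingHom (ZMod 17)) 0

theorem phi_ev (l : List ℤ) : phi (ev X l) = ((l.getD 0 0 : ℤ) : ZMod 17) := by
  rw [map_ev, phi, coe_eval₂RingHom, eval₂_X]
  cases l <;> simp [ev]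

def dif17 : List ℤ := ladd (ladd (lsmul (QL.getD 0 0) PL) (lsmul (-(PL.getD 0 0)) QL))
  (lsmul (-9) (0 :: (low17 ++ [1])))
def chkB : Bool := isZ (m17 dif17) && (isZ (PL.drop 13) && isZ (QL.drop 10))
theorem chkB_eq : chkB = true := by decide +kernel
theorem chkB' : isZ (m17 dif17) = true ∧ isZ (PL.drop 13) = true ∧ isZ (QL.drop 10) = true := by
  have := chkB_eq
  simpa only [chkB, Bool.and_eq_true] using this

theorem ht_map : ht.map phi = C 9 * f17 := by
  have h1 := congrArg (map phi) ht_mul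
  have hX : (X : ℤ[X]) = ev X [0, 1] := by simp [ev]
  have hX0 : phi X = 0 := by rw [phi, coe_eval₂RingHom, eval₂_X]
  rw [Polynomial.map_mul, Polynomial.map_sub, map_X, map_C, hX0, map_zero, sub_zero, GG, Polynomial.map_sub,
    Polynomial.map_mul, Polynomial.map_mul, map_C, map_C, map_ev', map_ev', phi_ev, phi_ev] at h1
  have h17 : (17 : (ZMod 17)[X]) = 0 := by
    rw [← map_ofNat (C : ZMod 17 →+* _) 17]
    exact (congrArg C (by decide : (17 : ZMod 17) = 0)).trans (map_zero _)
  have h2 := ev_isZ (X : (ZMod 17)[X]) _ chkB'.1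
  rw [ev_m17 h17, dif17, ev_ladd, ev_ladd, ev_lsmul, ev_lsmul, ev_lsmul] at h2
  have h3 : ev (X : (ZMod 17)[X]) (0 :: (low17 ++ [1])) = X * f17 := by
    rw [ev, ev_append, f17]
    simp [ev, low17]
  rw [h3] at h2
  apply mul_left_cancel₀ (X_ne_zero (R := ZMod 17))
  rw [h1, show (C 9 : (ZMod 17)[X]) = 9 from map_ofNat C 9, map_intCast, map_intCast]
  push_cast at h2
  linear_combination h2

theorem ht_map_irr : Irreducible (ht.map phi) := by
  rw [ht_map]
  exact (irreducible_isUnit_mul (isUnit_C.mpr (isUnit_iff_ne_zero.mpr (by decide)))).mpr f17_irr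

theorem ht_deg : ht.natDegree = 11 := by
  apply le_antisymm
  · rw [ht, natDegree_divByMonic _ (monic_X_sub_C (X : ℤ[X])), natDegree_X_sub_C]
    have : GG.natDegree ≤ 12 := by
      rw [natDegree_le_iff_coeff_eq_zero]
      intro i hi
      rw [GG, coeff_sub, coeff_mul_C, coeff_mul_C, coeff_ev, coeff_ev, getD_isZ _ _ chkB'.2.1 i (by omega),
        getD_isZ _ _ chkB'.2.2 i (by omega)]
      simp
    omega
  · have h1 : (ht.map phi).natDegree = 11 := by
      rw [ht_map, natDegree_C_mul (by decide), f17_deg]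
    rw [← h1]; exact natDegree_map_le

theorem ht_irr : Irreducible (ht.map (algebraMap ℤ[X] (FractionRing ℤ[X]))) := by
  refine irr_of_map phi ht ?_ ht_map_irr
  have h1 : (ht.map phi).natDegree = 11 := by
    rw [ht_map, natDegree_C_mul (by decide), f17_deg]
  have h2 : (ht.map phi).leadingCoeff ≠ 0 := leadingCoeff_ne_zero.mpr ht_map_irr.ne_zero
  rw [leadingCoeff, h1, coeff_map] at h2
  rwa [leadingCoeff, ht_deg]
end Cert

namespace Cert
open Polynomial
def h1L : List ℤ := [4508281300847688731169319769769841835444, 87907368140554183100162, 217019]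
def h2L : List ℤ := [14635567009082568185596461891292367332677180975427256879233264, 246529569778532375140876985021306849541294312, 37258218541488534910719399]
def h3L : List ℤ := [8443409213944751989643951279235627283533452107433272, 274156098050901691661379937349434622, 2223585235421468919]
def h4L : List ℤ := [16436156522418265669179020769359057896808189915554213257292620245, 225702085730490664288660568855789598873301353168, 0, 13385859493702]
theorem bez13 : isZ (ladd (ladd (lmul [-490165373295364608634157942071985056007006767632927149, -7774739878975303406505282872838160245] h1L)
  (lmul [261650084502919343356977607816695690639949, 758804406018431264335745] h3L))
  [-(-584652429147158118220278675501555381606326430373147405609758472603946209347480939003086028)]) = true := by decide +kernel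
theorem cop13 {M : Type*} [Field M] [CharZero M] (x : M) (ha : ev x h1L = 0) (hb : ev x h3L = 0) : False := by
  have := ev_isZ x _ bez13
  rw [ev_ladd, ev_ladd, ev_lmul, ev_lmul, ha, hb] at this
  simp only [ev] at this
  norm_num at this
theorem bez14 : isZ (ladd (ladd (lmul [15789309431798064582281018816164768487630064914991887391618863972473318322140, -46428140262014304235909124815404700826179985197452863275994, 771188175772865861005776962500618216604416] h1L)
  (lmul [-4311813845718420175386783209457414616795493284076203, -12502931679269085411037625977146752] h4L))
  [-(313001200915062365995860372692068624263328074410705623784047610217710589204528655072680710155714794588127941400425)]) = true := by decide +kernel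
theorem cop14 {M : Type*} [Field M] [CharZero M] (x : M) (ha : ev x h1L = 0) (hb : ev x h4L = 0) : False := by
  have := ev_isZ x _ bez14
  rw [ev_ladd, ev_ladd, ev_lmul, ev_lmul, ha, hb] at this
  simp only [ev] at this
  norm_num at this
theorem bez23 : isZ (ladd (ladd (lmul [-464698210173744550754775734802736007585479482150083840204342, -7331266572326406476235395937718207735660425] h2L)
  (lmul [805460422963723238822406667640532326360350039768354426537605550542732, 122842123515842053129688671736127209080314964126425] h3L))
  [-(-289837278835296454347386149678802227701413712670988925419202070346353844555240149103825988156860547876231038969053184)]) = true := by decide +kernel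
theorem cop23 {M : Type*} [Field M] [CharZero M] (x : M) (ha : ev x h2L = 0) (hb : ev x h3L = 0) : False := by
  have := ev_isZ x _ bez23
  rw [ev_ladd, ev_ladd, ev_lmul, ev_lmul, ha, hb] at this
  simp only [ev] at this
  norm_num at this
theorem bez24 : isZ (ladd (ladd (lmul [26332613231806684847246598380205183142227374327471231231475014075525632268823720669279894076875027561744357152461779800140472560, -77139458044412363922159416507736648501061208104761964698846222118112464992186459001521102671575949088488838426, 1287613597316305732610180590805173440536056914067447642780323865040078884806205814664047434464] h2L)
  (lmul [-23499480743047266346811580529512325707418073690168366451720351728964522324508888379599906769038203081032438605558716537579447, -3583945343843988655169783080486082549241564064751592219596145641111516185991361922461481612837156638702768] h4L))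
  [-(-848418209917736646182268034179441152632512804853845950936300812502848028893282128197518172433028669091487488764876074931033032556588880061859582367065835983918015268070542370221056868675)]) = true := by decide +kernel
theorem cop24 {M : Type*} [Field M] [CharZero M] (x : M) (ha : ev x h2L = 0) (hb : ev x h4L = 0) : False := by
  have := ev_isZ x _ bez24
  rw [ev_ladd, ev_ladd, ev_lmul, ev_lmul, ha, hb] at this
  simp only [ev] at this
  norm_num at this

section
variable {M : Type*} [Field M] [CharZero M]

theorem cop (x : M) (ha : ev x PL = 0) (hb : ev x QL = 0) : False := by
  have h1 : ev x PL = ev x h1L ^ 5 * ev x h2L := by rw [← ev_lpow, ← ev_lmul]; rfl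
  have h2 : ev x QL = ev x h3L ^ 3 * ev x h4L := by rw [← ev_lpow, ← ev_lmul]; rfl
  rw [h1, mul_eq_zero, pow_eq_zero_iff (by norm_num)] at ha
  rw [h2, mul_eq_zero, pow_eq_zero_iff (by norm_num)] at hb
  rcases ha with ha | ha <;> rcases hb with hb | hb
  · exact cop13 x ha hb
  · exact cop14 x ha hb
  · exact cop23 x ha hb
  · exact cop24 x ha hb

theorem hp_eval (T x : M) : (hp T).eval x = ev x PL - T * ev x QL := by
  rw [hp, eval_sub, eval_mul, eval_C, eval_ev', eval_ev']

theorem Q_ne {T x : M} (hx : (hp T).eval x = 0) : ev x QL ≠ 0 := by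
  intro h
  rw [hp_eval, h] at hx
  exact cop x (by linear_combination hx) h

theorem T_eq {T x : M} (hx : (hp T).eval x = 0) : T = ev x PL / ev x QL := by
  rw [eq_div_iff (Q_ne hx)]
  rw [hp_eval] at hx; linear_combination -hx

theorem x_trans {T x : M} (hT : Transcendental ℚ T) (hx : (hp T).eval x = 0) : Transcendental ℚ x := by
  intro h
  apply hT
  rw [T_eq hx, div_eq_mul_inv]
  exact (alg_ev x h _).mul (alg_ev x h _).inv

theorem e_inj {x : M} (hx : Transcendental ℚ x) :
    Function.Injective (aeval x : ℤ[X] →ₐ[ℤ] M).toRingHom := by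
  rw [injective_iff_map_eq_zero]
  intro p hp
  have h1 : aeval x (p.map (Int.castRingHom ℚ)) = 0 := by
    rw [← hp]
    have : (Int.castRingHom ℚ) = algebraMap ℤ ℚ := rfl
    rw [this, aeval_map_algebraMap]; rfl
  have := (transcendental_iff.mp hx) _ h1
  exact (Polynomial.map_eq_zero_iff Int.cast_injective).mp this

theorem factor {T x : M} (hx : (hp T).eval x = 0) :
    C (ev x QL) * hp T = (X - C x) * ht.map (aeval x : ℤ[X] →ₐ[ℤ] M).toRingHom := by
  have h := congrArg (map (aeval x : ℤ[X] →ₐ[ℤ] M).toRingHom) ht_mul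
  have e1 : ∀ l, (aeval x : ℤ[X] →ₐ[ℤ] M).toRingHom (ev X l) = ev x l := by
    intro l; rw [map_ev]; simp
  have e2 : (aeval x : ℤ[X] →ₐ[ℤ] M).toRingHom X = x := by simp
  rw [Polynomial.map_mul, Polynomial.map_sub, map_X, map_C, e2, GG, Polynomial.map_sub,
    Polynomial.map_mul, Polynomial.map_mul, map_C, map_C, map_ev', map_ev', e1, e1] at h
  rw [h, hp]
  have : ev x PL = T * ev x QL := by rw [hp_eval] at hx; linear_combination hx
  rw [this, C_mul]; ring

variable [IsAlgClosed M] [Algebra (RatFunc ℚ) M] [Algebra.IsAlgebraic (RatFunc ℚ) M]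

theorem stab {T x : M} (hTe : T = algebraMap (RatFunc ℚ) M RatFunc.X)
    (hT : Transcendental ℚ T) (hx : (hp T).eval x = 0) :
    ∃ q : M[X], C (ev x QL) * hp T = (X - C x) * q ∧ q.roots.Nodup ∧ q.natDegree = 11 ∧
      q.eval x ≠ 0 ∧ ∀ y y', q.eval y = 0 → q.eval y' = 0 →
        ∃ σ : M ≃+* M, σ T = T ∧ σ x = x ∧ σ y = y' := by
  have hxt := x_trans hT hx
  let K1 := FractionRing ℤ[X]
  let e : ℤ[X] →+* M := (aeval x : ℤ[X] →ₐ[ℤ] M).toRingHom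
  have he : Function.Injective e := e_inj hxt
  let _ : Algebra K1 M := (IsFractionRing.lift he : K1 →+* M).toAlgebra
  have hcomp : ∀ p, algebraMap K1 M (algebraMap ℤ[X] K1 p) = e p := fun p =>
    IsFractionRing.lift_algebraMap he p
  have hcomp' : (algebraMap K1 M).comp (algebraMap ℤ[X] K1) = e := RingHom.ext hcomp
  have hex : e X = x := by simp [e]
  have hee : ∀ l, e (ev X l) = ev x l := by intro l; rw [map_ev, hex]
  let L := algebraicClosure K1 M
  have hTL : T ∈ L := by
    rw [T_eq hx, ← hee, ← hee, ← hcomp, ← hcomp]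
    exact div_mem (L.algebraMap_mem _) (L.algebraMap_mem _)
  have hFL : ∀ a : RatFunc ℚ, algebraMap (RatFunc ℚ) M a ∈ L := by
    have hpol : ∀ p : ℚ[X], algebraMap (RatFunc ℚ) M (algebraMap ℚ[X] (RatFunc ℚ) p) ∈ L := by
      intro p
      induction p using Polynomial.induction_on' with
      | add p q hp hq => rw [map_add, map_add]; exact add_mem hp hq
      | monomial n a =>
        rw [← C_mul_X_pow_eq_monomial, map_mul, map_mul, map_pow, map_pow, RatFunc.algebraMap_X, ← hTe]
        refine mul_mem ?_ (pow_mem hTL n)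
        have : (algebraMap (RatFunc ℚ) M (algebraMap ℚ[X] (RatFunc ℚ) (C a))) = ((a : ℚ) : M) := by
          exact map_ratCast ((algebraMap (RatFunc ℚ) M).comp ((algebraMap ℚ[X] (RatFunc ℚ)).comp C)) a
        rw [this]
        exact SubfieldClass.ratCast_mem L a
    intro a
    rw [← RatFunc.num_div_denom a, map_div₀]
    exact div_mem (hpol _) (hpol _)
  have halg : Algebra.IsAlgebraic K1 M := by
    refine ⟨fun m => ?_⟩
    obtain ⟨p, hp0, hpm⟩ := Algebra.IsAlgebraic.isAlgebraic (R := RatFunc ℚ) m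
    let ψ : RatFunc ℚ →+* L := (algebraMap (RatFunc ℚ) M).codRestrict L hFL
    have hL : IsAlgebraic L m := by
      refine ⟨p.map ψ, ?_, ?_⟩
      · rwa [Ne, Polynomial.map_eq_zero]
      · rw [aeval_def, eval₂_map]
        exact hpm
    have : Algebra.IsAlgebraic K1 L := algebraicClosure.isAlgebraic K1 M
    exact hL.restrictScalars K1
  have hcl : IsAlgClosure K1 M := ⟨inferInstance, halg⟩
  have hnorm : Normal K1 M := IsAlgClosure.normal K1 M
  have hcharK : CharZero K1 := inferInstance
  let p := ht.map (algebraMap ℤ[X] K1)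
  have hirr : Irreducible p := ht_irr
  have hpm : p.map (algebraMap K1 M) = ht.map e := by rw [Polynomial.map_map, hcomp']
  have hpd : p.natDegree = 11 := by
    rw [natDegree_map_eq_of_injective (FaithfulSMul.algebraMap_injective ℤ[X] K1), ht_deg]
  have hpe : ∀ y, aeval y p = (ht.map e).eval y := by
    intro y; rw [← hpm, eval_map_algebraMap]
  refine ⟨ht.map e, factor hx, ?_, ?_, ?_, ?_⟩
  · rw [← hpm]
    exact nodup_roots (hirr.separable.map)
  · rw [natDegree_map_eq_of_injective he, ht_deg]
  · rw [← hpe]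
    intro h0
    rw [← hex, ← hcomp, aeval_algebraMap_apply, map_eq_zero] at h0
    have := degree_eq_one_of_irreducible_of_root hirr (x := algebraMap ℤ[X] K1 X) h0
    rw [degree_eq_natDegree hirr.ne_zero, hpd] at this
    norm_num at this
  · intro y y' hy hy'
    rw [← hpe] at hy hy'
    have hc : IsConjRoot K1 y' y := by
      rw [IsConjRoot, ← minpoly.eq_of_irreducible hirr hy, ← minpoly.eq_of_irreducible hirr hy']
    obtain ⟨σ, hσ⟩ := hc.exists_algEquiv
    have hσx : σ x = x := by rw [← hex, ← hcomp, σ.commutes]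
    refine ⟨σ.toRingEquiv, ?_, hσx, hσ⟩
    change σ T = T
    rw [T_eq hx, map_div₀]
    have : ∀ l, σ (ev x l) = ev x l := by
      intro l
      have := map_ev (σ.toRingEquiv.toRingHom) x l
      have h2 : σ.toRingEquiv.toRingHom x = x := hσx
      rw [h2] at this
      exact this
    rw [this, this]
end
end Cert

namespace Cert
open Polynomial

section
variable {M : Type*} [Field M] [CharZero M]

theorem hp_deg (T : M) : (hp T).natDegree = 12 := by
  apply le_antisymm
  · rw [natDegree_le_iff_coeff_eq_zero]
    intro i hi
    rw [hp, coeff_sub, coeff_C_mul, coeff_ev, coeff_ev, getD_isZ _ _ chkB'.2.1 i (by omega),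
      getD_isZ _ _ chkB'.2.2 i (by omega)]
    simp
  · apply le_natDegree_of_ne_zero
    rw [hp, coeff_sub, coeff_C_mul, coeff_ev, coeff_ev, getD_isZ _ QL chkB'.2.2 12 (by omega)]
    have h2 := chk'.2.2.2.2.2.2.2.2.2.2.1
    simp only [Int.cast_zero, mul_zero, sub_zero]
    exact Int.cast_ne_zero.mpr h2

theorem hp_map (σ : M ≃+* M) {T x : M} (hσ : σ T = T) (hx : (hp T).eval x = 0) :
    (hp T).eval (σ x) = 0 := by
  rw [hp_eval] at hx ⊢
  have e1 : ∀ l, ev (σ x) l = σ (ev x l) := fun l => (map_ev σ.toRingHom x l).symm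
  rw [e1, e1]
  conv_lhs => rw [← hσ]
  rw [← map_mul, ← map_sub, hx, map_zero]

variable [IsAlgClosed M] [Algebra (RatFunc ℚ) M] [Algebra.IsAlgebraic (RatFunc ℚ) M]

theorem stab' {T x y y' : M} (hTe : T = algebraMap (RatFunc ℚ) M RatFunc.X)
    (hT : Transcendental ℚ T) (hx : (hp T).eval x = 0) (hy : (hp T).eval y = 0)
    (hy' : (hp T).eval y' = 0) (hyx : y ≠ x) (hyx' : y' ≠ x) :
    ∃ σ : M ≃+* M, σ T = T ∧ σ x = x ∧ σ y = y' := by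
  obtain ⟨q, hq, -, -, -, h5⟩ := stab hTe hT hx
  have key : ∀ y, (hp T).eval y = 0 → y ≠ x → q.eval y = 0 := by
    intro y hy hyx
    have := congrArg (eval y) hq
    rw [eval_mul, eval_mul, hy, mul_zero, eval_sub, eval_X, eval_C] at this
    exact (mul_eq_zero.mp this.symm).resolve_left (sub_ne_zero.mpr hyx)
  exact h5 y y' (key y hy hyx) (key y' hy' hyx')

theorem hp_roots {T : M} (hTe : T = algebraMap (RatFunc ℚ) M RatFunc.X)
    (hT : Transcendental ℚ T) : (hp T).roots.Nodup ∧ Multiset.card (hp T).roots = 12 := by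
  refine ⟨?_, ?_⟩
  · obtain ⟨x, hx⟩ := IsAlgClosed.exists_root (hp T) (by
      rw [degree_eq_natDegree (hp_ne T), hp_deg]; norm_num)
    obtain ⟨q, hq, h2, h3, h4, -⟩ := stab hTe hT hx
    have hr : (hp T).roots = x ::ₘ q.roots := by
      have h0 : (X - C x) * q ≠ 0 := by
        rw [← hq]
        exact mul_ne_zero (C_ne_zero.mpr (Q_ne hx)) (hp_ne T)
      rw [← roots_C_mul (hp T) (Q_ne hx), hq, roots_mul h0, roots_X_sub_C, Multiset.singleton_add]
    rw [hr, Multiset.nodup_cons]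
    exact ⟨fun hm => h4 (mem_roots'.mp hm).2, h2⟩
  · rw [← hp_deg T]
    exact (splits_iff_card_roots.mp (IsAlgClosed.splits (hp T)))

theorem two_tr {T : M} (hTe : T = algebraMap (RatFunc ℚ) M RatFunc.X)
    (hT : Transcendental ℚ T) (r : Fin 12 → M) (hi : Function.Injective r)
    (hr : ∀ i, (hp T).eval (r i) = 0) (a b c d : Fin 12) (hab : a ≠ b) (hcd : c ≠ d) :
    ∃ σ : M ≃+* M, σ T = T ∧ σ (r a) = r c ∧ σ (r b) = r d := by
  obtain ⟨σ, h1, h2⟩ : ∃ σ : M ≃+* M, σ T = T ∧ σ (r a) = r c := by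
    obtain ⟨z, hz1, hz2⟩ : ∃ z : Fin 12, a ≠ z ∧ c ≠ z := by
      have key : ∀ a c : Fin 12, ∃ z : Fin 12, a ≠ z ∧ c ≠ z := by decide
      exact key a c
    obtain ⟨σ, h1, -, h2⟩ := stab' hTe hT (hr z) (hr a) (hr c) (hi.ne hz1) (hi.ne hz2)
    exact ⟨σ, h1, h2⟩
  have hb : σ (r b) ≠ r c := by
    rw [← h2]; exact fun h => hab (hi (σ.injective h)).symm
  obtain ⟨τ, h3, h4, h5⟩ := stab' hTe hT (hr c) (hp_map σ h1 (hr b)) (hr d) hb (hi.ne hcd.symm)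
  refine ⟨σ.trans τ, ?_, ?_, ?_⟩
  · simp [h1, h3]
  · simp [h2, h4]
  · simp [h5]

theorem fixF (σ : M ≃+* M) (h : σ (algebraMap (RatFunc ℚ) M RatFunc.X) = algebraMap (RatFunc ℚ) M RatFunc.X)
    (a : RatFunc ℚ) : σ (algebraMap (RatFunc ℚ) M a) = algebraMap (RatFunc ℚ) M a := by
  have hpol : ∀ p : ℚ[X], σ (algebraMap (RatFunc ℚ) M (algebraMap ℚ[X] (RatFunc ℚ) p))
      = algebraMap (RatFunc ℚ) M (algebraMap ℚ[X] (RatFunc ℚ) p) := by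
    intro p
    have : (σ.toRingHom.comp ((algebraMap (RatFunc ℚ) M).comp (algebraMap ℚ[X] (RatFunc ℚ))))
        = (algebraMap (RatFunc ℚ) M).comp (algebraMap ℚ[X] (RatFunc ℚ)) := by
      apply Polynomial.ringHom_ext'
      · exact Subsingleton.elim _ _
      · simpa [RatFunc.algebraMap_X] using h
    exact RingHom.congr_fun this p
  rw [← RatFunc.num_div_denom a, map_div₀, map_div₀, hpol, hpol]
end

theorem h_map {M : Type*} [Field M] [CharZero M] [Algebra (RatFunc ℚ) M] :
    h.map (algebraMap (RatFunc ℚ) M) = hp (algebraMap (RatFunc ℚ) M RatFunc.X) := by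
  have hP : ev (X : M[X]) PL = ev X h1L ^ 5 * ev X h2L := by rw [← ev_lpow, ← ev_lmul]; rfl
  have hQ : ev (X : M[X]) QL = ev X h3L ^ 3 * ev X h4L := by rw [← ev_lpow, ← ev_lmul]; rfl
  have hC : ∀ n : ℕ, [n.AtLeastTwo] → (C (algebraMap (RatFunc ℚ) M (OfNat.ofNat n)) : M[X]) = OfNat.ofNat n := by
    intro n _
    rw [map_ofNat, map_ofNat]
  rw [hp, hP, hQ, h, h1, h2, h3, h4, t]
  simp only [Polynomial.map_sub, Polynomial.map_mul, Polynomial.map_pow, Polynomial.map_add, map_C,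
    map_X, hC]
  simp only [h1L, h2L, h3L, h4L, ev, Int.cast_ofNat, Int.cast_zero]
  ring

theorem gal_main : h.natDegree = 12 ∧ IsSimpleGroup h.Gal ∧ Nat.card h.Gal = 7920 := by
  let M := AlgebraicClosure (RatFunc ℚ)
  have hc : CharZero M := inferInstance
  let T : M := algebraMap (RatFunc ℚ) M RatFunc.X
  have hm : h.map (algebraMap (RatFunc ℚ) M) = hp T := h_map
  have hd : h.natDegree = 12 := by
    rw [← hp_deg T, ← hm, natDegree_map]
  refine ⟨hd, ?_⟩
  have hT : Transcendental ℚ T := by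
    have h1 : Transcendental ℚ (RatFunc.X : RatFunc ℚ) := by
      convert RatFunc.transcendental_X (K := ℚ)
      exact Subsingleton.elim _ _
    intro h2
    apply h1
    obtain ⟨p, hp0, hp1⟩ := h2
    refine ⟨p, hp0, ?_⟩
    apply (algebraMap (RatFunc ℚ) M).injective
    rw [map_zero, ← hp1, aeval_def, aeval_def, hom_eval₂]
    congr 1
  obtain ⟨hnd, hcard⟩ := hp_roots (M := M) (T := T) rfl hT
  have hh0 : h ≠ 0 := by intro h0; rw [h0] at hd; simp at hd
  have hsp : Fact ((h.map (algebraMap (RatFunc ℚ) M)).Splits) := ⟨IsAlgClosed.splits _⟩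
  have hmem : ∀ x : M, x ∈ h.rootSet M ↔ (hp T).eval x = 0 := by
    intro x
    rw [mem_rootSet, ← hm, eval_map_algebraMap]
    simp [hh0]
  classical
  have hcr : Fintype.card (h.rootSet M) = 12 := by
    rw [← hcard, ← hm]
    have h1 : (h.rootSet M : Set M) = ((hp T).roots.toFinset : Set M) := by
      ext x; rw [hmem]; simp [hp_ne]
    rw [← Set.toFinset_card, hm, ← Multiset.toFinset_card_of_nodup hnd]
    congr 1
    ext x
    rw [Set.mem_toFinset, hmem]; simp [hp_ne]
  let e : h.rootSet M ≃ Fin 12 := Fintype.equivFinOfCardEq hcr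
  let r : Fin 12 → M := fun i => (e.symm i : M)
  have hi : Function.Injective r := Subtype.val_injective.comp e.symm.injective
  have hr : ∀ i, (hp T).eval (r i) = 0 := fun i => (hmem _).mp (e.symm i).2
  let Φ : h.Gal →* Equiv.Perm (Fin 12) :=
    (e.permCongrHom : Equiv.Perm (h.rootSet M) →* Equiv.Perm (Fin 12)).comp (Gal.galActionHom h M)
  have hΦ : Function.Injective Φ :=
    (e.permCongrHom.injective).comp (Gal.galActionHom_injective h M)
  have hΦa : ∀ (σ : M ≃ₐ[RatFunc ℚ] M) (i : Fin 12), r (Φ (Gal.restrict h M σ) i) = σ (r i) := by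
    intro σ i
    have h1 : Φ (Gal.restrict h M σ) i = e (Gal.galActionHom h M (Gal.restrict h M σ) (e.symm i)) := rfl
    simp only [r]
    rw [h1, Equiv.symm_apply_apply, Gal.galActionHom_restrict]
  have hfin := main_group (M := M) r hT hi hr Φ.range ?_ ?_
  · let E : h.Gal ≃* Φ.range := MonoidHom.ofInjective hΦ
    obtain ⟨h1, h2⟩ := hfin
    refine ⟨?_, ?_⟩
    · exact E.isSimpleGroup
    · rw [← h2]; exact Nat.card_congr E.toEquiv
  · intro a b c d hab hcd
    obtain ⟨σ, h1, h2, h3⟩ := two_tr (M := M) (T := T) rfl hT r hi hr a b c d hab hcd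
    let σ' : M ≃ₐ[RatFunc ℚ] M := AlgEquiv.ofRingEquiv (f := σ) (fixF σ h1)
    refine ⟨Φ (Gal.restrict h M σ'), ⟨_, rfl⟩, ?_, ?_⟩
    · apply hi; rw [hΦa]; exact h2
    · apply hi; rw [hΦa]; exact h3
  · rintro g ⟨γ, rfl⟩
    obtain ⟨σ, rfl⟩ := Gal.restrict_surjective h M γ
    refine ⟨σ.toRingEquiv, σ.commutes _, fun i => ?_⟩
    rw [hΦa]; rfl
end Cert

theorem m11_totally_real_family :
    h.natDegree = 12 ∧ IsSimpleGroup h.Gal ∧ Nat.card h.Gal = 7920 := Cert.gal_main
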